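/- arXiv:2403.13142 — 3 statements merged into one kernel-verified Lean document; each statement's English description precedes it below -/
import Mathlib

section
/- Let d be real with 1 < d < 4 and d ≠ 2, and let λ > 0, ν > 0 be real with λ ≠ ν. Then the one-loop bubble integral converges and (2·π^(d/2)/Γ(d/2)) · ∫₁^∞ G(d,λ,u)·G(d,ν,u)·(u²−1)^((d−2)/2) du = (Γ(1−d/2)/(2^d·π^(d/2)·(λ²−ν²))) · ( Γ((d−1)/2+ν)/Γ((3−d)/2+ν) − Γ((d−1)/2+λ)/Γ((3−d)/2+λ) ). -/
open MeasureTheory Real Filter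

/-- The AdS propagator, defined for real parameters `d`, `μ` and real `u > 1` by its
hypergeometric series. -/
noncomputable def adsG (d μ u : ℝ) : ℝ :=
  Real.Gamma ((d - 1) / 2 + μ) /
      (2 * Real.pi ^ ((d - 1) / 2) * Real.Gamma (μ + 1) * (2 * u) ^ ((d - 1) / 2 + μ)) *
    ∑' n : ℕ,
      (ascPochhammer ℝ n).eval ((d - 1) / 4 + μ / 2) *
          (ascPochhammer ℝ n).eval ((d + 1) / 4 + μ / 2) /
          ((ascPochhammer ℝ n).eval (μ + 1) * (n.factorial : ℝ)) *
        u ^ (-(2 : ℝ) * n)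

lemma integrableOn_Ioo_beta {p q : ℝ} (hp : 0 < p) (hq : 0 < q) :
    IntegrableOn (fun x : ℝ => x ^ (q - 1) * (1 - x) ^ (p - 1)) (Set.Ioo 0 1) := by
  have h := Complex.betaIntegral_convergent (u := q) (v := p) (by simpa) (by simpa)
  rw [intervalIntegrable_iff_integrableOn_Ioo_of_le zero_le_one] at h
  refine IntegrableOn.congr_fun h.norm (fun x hx => ?_) measurableSet_Ioo
  have h1 : (0 : ℝ) < 1 - x := sub_pos.2 hx.2
  have e : (1 : ℂ) - x = ((1 - x : ℝ) : ℂ) := by push_cast; ring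
  simp only [norm_mul]
  rw [e, Complex.norm_cpow_eq_rpow_re_of_pos hx.1, Complex.norm_cpow_eq_rpow_re_of_pos h1]
  simp

lemma integral_Ioo_beta {p q : ℝ} (hp : 0 < p) (hq : 0 < q) :
    ∫ x in Set.Ioo (0 : ℝ) 1, x ^ (q - 1) * (1 - x) ^ (p - 1) =
      Real.Gamma p * Real.Gamma q / Real.Gamma (p + q) := by
  have h := ProbabilityTheory.beta_eq_betaIntegralReal q p hq hp
  have e : Complex.betaIntegral q p =
      ((∫ x in Set.Ioo (0 : ℝ) 1, x ^ (q - 1) * (1 - x) ^ (p - 1) : ℝ) : ℂ) := by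
    rw [Complex.betaIntegral, intervalIntegral.integral_of_le zero_le_one,
      integral_Ioc_eq_integral_Ioo, ← integral_complex_ofReal]
    refine setIntegral_congr_fun measurableSet_Ioo fun x hx => ?_
    have h1 : (0 : ℝ) < 1 - x := sub_pos.2 hx.2
    rw [Complex.ofReal_mul, Complex.ofReal_cpow hx.1.le, Complex.ofReal_cpow h1.le]
    push_cast
    rfl
  rw [e, Complex.ofReal_re] at h
  rw [← h, ProbabilityTheory.beta, add_comm q p, mul_comm (Real.Gamma q)]

lemma image_two_mul_sub_one_Ioo :
    Set.image (fun x : ℝ => 2 * x - 1) (Set.Ioo 0 1) = Set.Ioo (-1) 1 := by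
  ext t
  constructor
  · rintro ⟨x, hx, rfl⟩
    constructor <;> simp only <;> linarith [hx.1, hx.2]
  · intro ht
    exact ⟨(t + 1) / 2, ⟨by linarith [ht.1], by linarith [ht.2]⟩, by ring⟩

lemma jacobi_comp_two_mul_sub_one {p q x : ℝ} (hx : x ∈ Set.Ioo (0 : ℝ) 1) :
    |(2 : ℝ)| • ((1 - (2 * x - 1)) ^ (p - 1) * (1 + (2 * x - 1)) ^ (q - 1)) =
      2 ^ (p + q - 1) * (x ^ (q - 1) * (1 - x) ^ (p - 1)) := by
  have h1 : (0 : ℝ) < 1 - x := sub_pos.2 hx.2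
  have e1 : 1 - (2 * x - 1) = 2 * (1 - x) := by ring
  have e2 : 1 + (2 * x - 1) = 2 * x := by ring
  have e3 : (2 : ℝ) ^ (p + q - 1) = 2 * 2 ^ (p - 1) * 2 ^ (q - 1) := by
    rw [show p + q - 1 = 1 + (p - 1) + (q - 1) by ring, rpow_add two_pos, rpow_add two_pos,
      rpow_one]
  rw [e1, e2, mul_rpow two_pos.le h1.le, mul_rpow two_pos.le hx.1.le, e3, abs_two, smul_eq_mul]
  ring

lemma integrableOn_jacobi {p q : ℝ} (hp : 0 < p) (hq : 0 < q) :
    IntegrableOn (fun t : ℝ => (1 - t) ^ (p - 1) * (1 + t) ^ (q - 1)) (Set.Ioo (-1) 1) := by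
  rw [← image_two_mul_sub_one_Ioo,
    integrableOn_image_iff_integrableOn_abs_deriv_smul measurableSet_Ioo (f' := fun _ => 2)
      (fun x _ => by simpa using (((hasDerivAt_id x).const_mul 2).sub_const 1).hasDerivWithinAt)
      (fun x _ y _ h => by simpa using h)]
  exact IntegrableOn.congr_fun ((integrableOn_Ioo_beta hp hq).const_mul (2 ^ (p + q - 1)))
    (fun x hx => (jacobi_comp_two_mul_sub_one hx).symm) measurableSet_Ioo

lemma integral_jacobi {p q : ℝ} (hp : 0 < p) (hq : 0 < q) :
    ∫ t in Set.Ioo (-1 : ℝ) 1, (1 - t) ^ (p - 1) * (1 + t) ^ (q - 1) =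
      2 ^ (p + q - 1) * (Real.Gamma p * Real.Gamma q / Real.Gamma (p + q)) := by
  rw [← image_two_mul_sub_one_Ioo,
    integral_image_eq_integral_abs_deriv_smul measurableSet_Ioo (f' := fun _ => 2)
      (fun x _ => by simpa using (((hasDerivAt_id x).const_mul 2).sub_const 1).hasDerivWithinAt)
      (fun x _ y _ h => by simpa using h),
    setIntegral_congr_fun measurableSet_Ioo fun x hx => jacobi_comp_two_mul_sub_one hx,
    integral_const_mul, integral_Ioo_beta hp hq]

lemma one_sub_sq_pos {t : ℝ} (ht : t ∈ Set.Ioo (-1 : ℝ) 1) : 0 < 1 - t ^ 2 := by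
  nlinarith [ht.1, ht.2]

lemma one_sub_sq_rpow {t : ℝ} (ht : t ∈ Set.Ioo (-1 : ℝ) 1) (s : ℝ) :
    (1 - t ^ 2) ^ s = (1 - t) ^ s * (1 + t) ^ s := by
  rw [← mul_rpow (by linarith [ht.2]) (by linarith [ht.1])]
  ring_nf

lemma integrableOn_gegenbauer_mul {μ : ℝ} (hμ : -1 / 2 < μ) {f : ℝ → ℝ}
    (hf : ContinuousOn f (Set.Icc (-1) 1)) :
    IntegrableOn (fun t : ℝ => (1 - t ^ 2) ^ (μ - 1 / 2) * f t) (Set.Ioo (-1) 1) := by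
  have h : IntegrableOn (fun t : ℝ => (1 - t ^ 2) ^ (μ - 1 / 2)) (Set.Ioo (-1) 1) := by
    refine (integrableOn_jacobi (p := μ + 1 / 2) (q := μ + 1 / 2) (by linarith)
      (by linarith)).congr_fun (fun t ht => ?_) measurableSet_Ioo
    simp only
    rw [one_sub_sq_rpow ht, show μ + 1 / 2 - 1 = μ - 1 / 2 by ring]
  rw [← integrableOn_Icc_iff_integrableOn_Ioo] at h ⊢
  exact h.mul_continuousOn hf isCompact_Icc

/-- Integration by parts against the weight `(1 - t ^ 2) ^ (μ - 1 / 2)`: the boundary terms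
vanish. -/
lemma integral_gegenbauer_by_parts {μ : ℝ} (hμ : -1 / 2 < μ) {f f' : ℝ → ℝ}
    (hf : ∀ t ∈ Set.Icc (-1 : ℝ) 1, HasDerivAt f (f' t) t)
    (hf' : ContinuousOn f' (Set.Icc (-1) 1)) :
    ∫ t in Set.Ioo (-1 : ℝ) 1, (1 - t ^ 2) ^ (μ - 1 / 2) *
      ((1 - t ^ 2) * f' t - (2 * μ + 1) * t * f t) = 0 := by
  have hfc : ContinuousOn f (Set.Icc (-1) 1) := fun t ht =>
    (hf t ht).continuousAt.continuousWithinAt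
  have hint := integrableOn_gegenbauer_mul hμ
    (f := fun t => (1 - t ^ 2) * f' t - (2 * μ + 1) * t * f t) (by fun_prop)
  have key := intervalIntegral.integral_eq_sub_of_hasDerivAt_of_le (a := -1) (b := 1)
    (f := fun t => (1 - t ^ 2) ^ (μ + 1 / 2) * f t)
    (f' := fun t => (1 - t ^ 2) ^ (μ - 1 / 2) * ((1 - t ^ 2) * f' t - (2 * μ + 1) * t * f t))
    (by norm_num)
    (((by fun_prop : ContinuousOn (fun t : ℝ => 1 - t ^ 2) (Set.Icc (-1) 1)).rpow_const
      fun t _ => Or.inr (by linarith)).mul hfc)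
    (fun t ht => by
      have hpos := one_sub_sq_pos ht
      have h1 : HasDerivAt (fun t : ℝ => 1 - t ^ 2) (-(2 * t)) t := by
        simpa using (hasDerivAt_pow 2 t).const_sub 1
      refine ((h1.rpow_const (p := μ + 1 / 2) (Or.inl hpos.ne')).mul
        (hf t ⟨ht.1.le, ht.2.le⟩)).congr_deriv ?_
      rw [show μ + 1 / 2 = (μ - 1 / 2) + 1 by ring, rpow_add_one hpos.ne',
        show μ - 1 / 2 + 1 - 1 = μ - 1 / 2 by ring]
      ring)
    ((intervalIntegrable_iff_integrableOn_Ioo_of_le (by norm_num)).2 hint)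
  rw [intervalIntegral.integral_of_le (by norm_num), integral_Ioc_eq_integral_Ioo] at key
  rw [key]
  have h0 : (0 : ℝ) ^ (μ + 1 / 2) = 0 := zero_rpow (by linarith)
  rw [one_pow, neg_one_sq, sub_self, h0, zero_mul, zero_mul, sub_zero]

lemma integral_gegenbauer {μ : ℝ} (hμ : -1 / 2 < μ) :
    ∫ t in Set.Ioo (-1 : ℝ) 1, (1 - t ^ 2) ^ (μ - 1 / 2) =
      √π * Real.Gamma (μ + 1 / 2) / Real.Gamma (μ + 1) := by
  have hp : 0 < μ + 1 / 2 := by linarith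
  have e : ∫ t in Set.Ioo (-1 : ℝ) 1, (1 - t ^ 2) ^ (μ - 1 / 2) =
      ∫ t in Set.Ioo (-1 : ℝ) 1, (1 - t) ^ (μ + 1 / 2 - 1) * (1 + t) ^ (μ + 1 / 2 - 1) := by
    refine setIntegral_congr_fun measurableSet_Ioo fun t ht => ?_
    rw [one_sub_sq_rpow ht, show μ + 1 / 2 - 1 = μ - 1 / 2 by ring]
  have hdup := Real.Gamma_mul_Gamma_add_half (μ + 1 / 2)
  rw [e, integral_jacobi hp hp]
  have g1 := (Real.Gamma_pos_of_pos (show 0 < μ + 1 by linarith)).ne'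
  have g2 := (Real.Gamma_pos_of_pos (show 0 < 2 * (μ + 1 / 2) by linarith)).ne'
  rw [show μ + 1 / 2 + 1 / 2 = μ + 1 by ring] at hdup
  rw [show μ + 1 / 2 + (μ + 1 / 2) = 2 * (μ + 1 / 2) by ring, ← mul_div_assoc, div_eq_div_iff g2 g1]
  have h2 : (2 : ℝ) ^ (2 * (μ + 1 / 2) - 1) * 2 ^ (1 - 2 * (μ + 1 / 2)) = 1 := by
    rw [← rpow_add two_pos]; simp
  linear_combination (2 : ℝ) ^ (2 * (μ + 1 / 2) - 1) * Real.Gamma (μ + 1 / 2) * hdup +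
    Real.Gamma (μ + 1 / 2) * Real.Gamma (2 * (μ + 1 / 2)) * √π * h2

lemma integral_gegenbauer_even_moment {μ : ℝ} (hμ : -1 / 2 < μ) (n : ℕ) :
    ∫ t in Set.Ioo (-1 : ℝ) 1, (1 - t ^ 2) ^ (μ - 1 / 2) * t ^ (2 * n) =
      √π * Real.Gamma (μ + 1 / 2) / Real.Gamma (μ + 1) *
        ((ascPochhammer ℝ n).eval (1 / 2) / (ascPochhammer ℝ n).eval (μ + 1)) := by
  induction n with
  | zero => simpa using integral_gegenbauer hμ
  | succ n ih =>
    have key := integral_gegenbauer_by_parts hμ (f := fun t => t ^ (2 * n + 1))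
      (f' := fun t => (2 * n + 1) * t ^ (2 * n))
      (fun t _ => by simpa using hasDerivAt_pow (2 * n + 1) t) (by fun_prop)
    have hi := fun k : ℕ => integrableOn_gegenbauer_mul hμ (f := fun t => t ^ k) (by fun_prop)
    have e : ∫ t in Set.Ioo (-1 : ℝ) 1, (1 - t ^ 2) ^ (μ - 1 / 2) *
        ((1 - t ^ 2) * ((2 * n + 1) * t ^ (2 * n)) - (2 * μ + 1) * t * t ^ (2 * n + 1)) =
        ∫ t in Set.Ioo (-1 : ℝ) 1, ((2 * n + 1) * ((1 - t ^ 2) ^ (μ - 1 / 2) * t ^ (2 * n)) -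
          (2 * n + 2 + 2 * μ) * ((1 - t ^ 2) ^ (μ - 1 / 2) * t ^ (2 * (n + 1)))) := by
      congr 1; ext t; ring
    rw [e, integral_sub ((hi _).const_mul _) ((hi _).const_mul _), integral_const_mul,
      integral_const_mul, ih] at key
    have hpos : 0 < μ + 1 + n := by linarith [(Nat.cast_nonneg n : (0 : ℝ) ≤ n)]
    rw [ascPochhammer_succ_eval, ascPochhammer_succ_eval]
    have hP := (ascPochhammer_pos n (μ + 1) (by linarith)).ne'
    have g1 := (Real.Gamma_pos_of_pos (show 0 < μ + 1 by linarith)).ne'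
    field_simp at key ⊢
    linarith

lemma integral_gegenbauer_odd_moment (μ : ℝ) (n : ℕ) :
    ∫ t in Set.Ioo (-1 : ℝ) 1, (1 - t ^ 2) ^ (μ - 1 / 2) * t ^ (2 * n + 1) = 0 := by
  rw [← integral_Ioc_eq_integral_Ioo, ← intervalIntegral.integral_of_le (by norm_num)]
  have h := intervalIntegral.integral_comp_neg (a := -1) (b := 1)
    (fun t : ℝ => (1 - t ^ 2) ^ (μ - 1 / 2) * t ^ (2 * n + 1))
  have hodd : Odd (2 * n + 1) := ⟨n, rfl⟩
  simp only [neg_neg, even_two, Even.neg_pow, hodd.neg_pow, mul_neg,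
    intervalIntegral.integral_neg] at h
  linarith

lemma ascPochhammer_two_mul_eval (a : ℝ) (n : ℕ) :
    (ascPochhammer ℝ (2 * n)).eval a =
      4 ^ n * (ascPochhammer ℝ n).eval (a / 2) * (ascPochhammer ℝ n).eval ((a + 1) / 2) := by
  induction n with
  | zero => simp
  | succ n ih =>
    rw [show 2 * (n + 1) = 2 * n + 1 + 1 by ring, ascPochhammer_succ_eval,
      ascPochhammer_succ_eval, ascPochhammer_succ_eval, ascPochhammer_succ_eval, ih]
    push_cast
    ring

lemma ascPochhammer_half_eval (n : ℕ) :
    ((2 * n).factorial : ℝ) = 4 ^ n * (ascPochhammer ℝ n).eval (1 / 2) * n.factorial := by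
  have h := ascPochhammer_two_mul_eval 1 n
  rw [ascPochhammer_eval_one] at h
  rw [h]
  norm_num [ascPochhammer_eval_one]

lemma hasSum_ascPochhammer_mul_pow (a : ℝ) {z : ℝ} (hz : |z| < 1) :
    HasSum (fun n : ℕ => (ascPochhammer ℝ n).eval a / n.factorial * z ^ n) ((1 - z) ^ (-a)) := by
  have h := (Real.one_div_one_sub_rpow_hasFPowerSeriesOnBall_zero a).hasSum (y := z)
    (by simpa [enorm_eq_nnnorm, ← NNReal.coe_lt_coe] using hz)
  rw [zero_add, one_div, ← rpow_neg (by linarith [(abs_lt.1 hz).2])] at h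
  refine h.congr_fun fun n => ?_
  have hc : Ring.choose (a + n - 1) n = (ascPochhammer ℝ n).eval a / n.factorial := by
    rw [eq_div_iff (by positivity), mul_comm, ← nsmul_eq_mul, Ring.choose,
      Ring.factorial_nsmul_multichoose_eq_ascPochhammer,
      Polynomial.ascPochhammer_smeval_eq_eval]
    congr 1
    ring
  simp [FormalMultilinearSeries.ofScalars, hc, mul_comm]

/-- The Gegenbauer-type integral representing the propagator up to normalisation. -/
noncomputable def gegenbauerKernel (μ a u : ℝ) : ℝ :=
  ∫ t in Set.Ioo (-1 : ℝ) 1, (1 - t ^ 2) ^ (μ - 1 / 2) * (u - t) ^ (-a)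

lemma hasSum_gegenbauerKernel {μ a u : ℝ} (hμ : -1 / 2 < μ) (ha : 0 < a) (hu : 1 < u) :
    HasSum (fun n : ℕ => (ascPochhammer ℝ n).eval a / n.factorial * (u ^ n)⁻¹ *
      ∫ t in Set.Ioo (-1 : ℝ) 1, (1 - t ^ 2) ^ (μ - 1 / 2) * t ^ n)
      (u ^ a * gegenbauerKernel μ a u) := by
  have hu0 : 0 < u := by linarith
  have hcoef : ∀ n : ℕ, 0 ≤ (ascPochhammer ℝ n).eval a / n.factorial * (u ^ n)⁻¹ := fun n => by
    have := ascPochhammer_pos n a ha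
    positivity
  have hint : ∀ n : ℕ, IntegrableOn (fun t : ℝ => (1 - t ^ 2) ^ (μ - 1 / 2) * t ^ n)
      (Set.Ioo (-1) 1) := fun n => integrableOn_gegenbauer_mul hμ (by fun_prop)
  have key := hasSum_integral_of_summable_integral_norm
    (μ := volume.restrict (Set.Ioo (-1 : ℝ) 1))
    (F := fun n t => (ascPochhammer ℝ n).eval a / n.factorial * (u ^ n)⁻¹ *
      ((1 - t ^ 2) ^ (μ - 1 / 2) * t ^ n))
    (fun n => (hint n).const_mul _) (by
      have hs := (hasSum_ascPochhammer_mul_pow a (z := u⁻¹) (by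
        rw [abs_of_pos (by positivity)]; exact inv_lt_one_of_one_lt₀ hu)).summable
      refine Summable.of_nonneg_of_le (fun n => integral_nonneg fun t => norm_nonneg _)
        (fun n => ?_) (hs.mul_right (∫ t in Set.Ioo (-1 : ℝ) 1, (1 - t ^ 2) ^ (μ - 1 / 2)))
      rw [inv_pow, ← integral_const_mul]
      refine setIntegral_mono_on ((hint n).const_mul _).norm
        (IntegrableOn.congr_fun ((hint 0).const_mul _) (fun t _ => by rw [pow_zero, mul_one])
          measurableSet_Ioo) measurableSet_Ioo fun t ht => ?_
      rw [norm_mul, Real.norm_of_nonneg (hcoef n), norm_mul, norm_pow,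
        Real.norm_of_nonneg (rpow_nonneg (one_sub_sq_pos ht).le _)]
      refine mul_le_mul_of_nonneg_left ?_ (hcoef n)
      exact mul_le_of_le_one_right (rpow_nonneg (one_sub_sq_pos ht).le _)
        (pow_le_one₀ (norm_nonneg _) (abs_le.2 ⟨ht.1.le, ht.2.le⟩)))
  simp only [integral_const_mul] at key
  convert! key using 1
  rw [gegenbauerKernel, ← integral_const_mul]
  refine setIntegral_congr_fun measurableSet_Ioo fun t ht => ?_
  have htu : |t / u| < 1 := by
    rw [abs_div, abs_of_pos hu0, div_lt_one hu0]
    exact (abs_lt.2 ht).trans hu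
  have hsum := (hasSum_ascPochhammer_mul_pow a htu).mul_left ((1 - t ^ 2) ^ (μ - 1 / 2))
  have hpos : 0 < 1 - t / u := by linarith [(abs_lt.1 htu).2]
  rw [(hsum.congr_fun fun n => by rw [div_pow]; ring :
    HasSum (fun n : ℕ => (ascPochhammer ℝ n).eval a / n.factorial * (u ^ n)⁻¹ *
      ((1 - t ^ 2) ^ (μ - 1 / 2) * t ^ n)) _).tsum_eq,
    show u - t = u * (1 - t / u) by field_simp, mul_rpow hu0.le hpos.le, rpow_neg hu0.le]
  have := (rpow_pos_of_pos hu0 a).ne'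
  field_simp

lemma adsG_eq_gegenbauerKernel {d μ u : ℝ} (hd : 1 < d) (hμ : 0 < μ) (hu : 1 < u) :
    adsG d μ u = Real.Gamma ((d - 1) / 2 + μ) /
      (2 ^ ((d - 1) / 2 + μ + 1) * π ^ (d / 2) * Real.Gamma (μ + 1 / 2)) *
        gegenbauerKernel μ ((d - 1) / 2 + μ) u := by
  have hu0 : 0 < u := by linarith
  have hμ' : -1 / 2 < μ := by linarith
  have h := hasSum_gegenbauerKernel hμ' (a := (d - 1) / 2 + μ) (by linarith) hu
  rw [← (mul_right_injective₀ (two_ne_zero (α := ℕ))).hasSum_iff (fun n hn => by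
    obtain ⟨k, rfl⟩ : Odd n := by
      rw [← Nat.not_even_iff_odd]
      rintro ⟨k, rfl⟩
      exact hn ⟨k, two_mul k⟩
    rw [integral_gegenbauer_odd_moment, mul_zero])] at h
  have g1 := (Real.Gamma_pos_of_pos (show 0 < μ + 1 by linarith)).ne'
  have g2 := (Real.Gamma_pos_of_pos (show 0 < μ + 1 / 2 by linarith)).ne'
  have h' := (h.mul_left (Real.Gamma (μ + 1) / (√π * Real.Gamma (μ + 1 / 2)))).congr_fun
    (g := fun n : ℕ => (ascPochhammer ℝ n).eval ((d - 1) / 4 + μ / 2) *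
          (ascPochhammer ℝ n).eval ((d + 1) / 4 + μ / 2) /
          ((ascPochhammer ℝ n).eval (μ + 1) * (n.factorial : ℝ)) *
        u ^ (-(2 : ℝ) * n)) (fun n => by
      have hhalf := (ascPochhammer_pos n (1 / 2 : ℝ) (by norm_num)).ne'
      have hP := (ascPochhammer_pos n (μ + 1) (by linarith)).ne'
      have hupow : u ^ (-(2 : ℝ) * n) = (u ^ (2 * n))⁻¹ := by
        rw [neg_mul, rpow_neg hu0.le, ← Nat.cast_ofNat, ← Nat.cast_mul, rpow_natCast]
      simp only [Function.comp]
      rw [integral_gegenbauer_even_moment hμ', ascPochhammer_two_mul_eval,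
        ascPochhammer_half_eval, hupow,
        show ((d - 1) / 2 + μ) / 2 = (d - 1) / 4 + μ / 2 by ring,
        show ((d - 1) / 2 + μ + 1) / 2 = (d + 1) / 4 + μ / 2 by ring]
      field_simp)
  rw [adsG, h'.tsum_eq, mul_rpow two_pos.le hu0.le, rpow_add_one two_ne_zero,
    show d / 2 = (d - 1) / 2 + 1 / 2 by ring, rpow_add pi_pos, ← sqrt_eq_rpow]
  have h1 := (rpow_pos_of_pos hu0 ((d - 1) / 2 + μ)).ne'
  field_simp

lemma rpow_le_add_of_mem_Icc {lo hi x : ℝ} (hlo : 0 < lo) (h1 : lo ≤ x) (h2 : x ≤ hi) (p : ℝ) :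
    x ^ p ≤ lo ^ p + hi ^ p := by
  have hx : 0 < x := hlo.trans_le h1
  rcases le_total 0 p with hp | hp
  · exact (rpow_le_rpow hx.le h2 hp).trans (le_add_of_nonneg_left (rpow_nonneg hlo.le _))
  · exact (rpow_le_rpow_of_nonpos hlo h1 hp).trans
      (le_add_of_nonneg_right (rpow_nonneg (hx.le.trans h2) _))

lemma continuousOn_sub_rpow {u : ℝ} (hu : 1 < u) (p : ℝ) :
    ContinuousOn (fun t : ℝ => (u - t) ^ p) (Set.Icc (-1) 1) :=
  ContinuousOn.rpow_const (by fun_prop) fun t ht => Or.inl (by linarith [ht.2])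

lemma integrableOn_gegenbauerKernel {μ u : ℝ} (hμ : -1 / 2 < μ) (hu : 1 < u) (a : ℝ) :
    IntegrableOn (fun t : ℝ => (1 - t ^ 2) ^ (μ - 1 / 2) * (u - t) ^ (-a)) (Set.Ioo (-1) 1) :=
  integrableOn_gegenbauer_mul hμ (continuousOn_sub_rpow hu _)

lemma gegenbauerKernel_nonneg (μ a : ℝ) {u : ℝ} (hu : 1 < u) : 0 ≤ gegenbauerKernel μ a u :=
  setIntegral_nonneg measurableSet_Ioo fun t ht =>
    mul_nonneg (rpow_nonneg (one_sub_sq_pos ht).le _) (rpow_nonneg (by linarith [ht.2]) _)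

lemma gegenbauerKernel_le {μ a u : ℝ} (hμ : -1 / 2 < μ) (ha : 0 ≤ a) (hu : 1 < u) :
    gegenbauerKernel μ a u ≤
      (∫ t in Set.Ioo (-1 : ℝ) 1, (1 - t ^ 2) ^ (μ - 1 / 2)) * (u - 1) ^ (-a) := by
  rw [gegenbauerKernel, ← integral_mul_const]
  refine setIntegral_mono_on (integrableOn_gegenbauerKernel hμ hu a)
    (integrableOn_gegenbauer_mul hμ continuousOn_const) measurableSet_Ioo fun t ht => ?_
  exact mul_le_mul_of_nonneg_left
    (rpow_le_rpow_of_nonpos (by linarith) (by linarith [ht.2]) (by linarith))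
    (rpow_nonneg (one_sub_sq_pos ht).le _)

lemma hasDerivAt_gegenbauerKernel {μ u : ℝ} (hμ : -1 / 2 < μ) (hu : 1 < u) (a : ℝ) :
    HasDerivAt (gegenbauerKernel μ a) (-a * gegenbauerKernel μ (a + 1) u) u := by
  have hs : Set.Ioo ((u + 1) / 2) (u + 1) ∈ nhds u :=
    Ioo_mem_nhds (by linarith) (by linarith)
  have key := (hasDerivAt_integral_of_dominated_loc_of_deriv_le
    (μ := volume.restrict (Set.Ioo (-1 : ℝ) 1))
    (F := fun v t => (1 - t ^ 2) ^ (μ - 1 / 2) * (v - t) ^ (-a))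
    (F' := fun v t => -a * ((1 - t ^ 2) ^ (μ - 1 / 2) * (v - t) ^ (-(a + 1))))
    (bound := fun t => (1 - t ^ 2) ^ (μ - 1 / 2) *
      (|a| * (((u - 1) / 2) ^ (-(a + 1)) + (u + 2) ^ (-(a + 1))))) hs
    (by
      filter_upwards [hs] with v hv
      exact (integrableOn_gegenbauerKernel hμ (by linarith [hv.1]) a).aestronglyMeasurable)
    (integrableOn_gegenbauerKernel hμ hu a)
    ((integrableOn_gegenbauerKernel hμ hu (a + 1)).const_mul (-a)).aestronglyMeasurable
    (by
      refine (ae_restrict_iff' measurableSet_Ioo).2 (ae_of_all _ fun t ht v hv => ?_)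
      have hw := rpow_nonneg (one_sub_sq_pos ht).le (μ - 1 / 2)
      have hvt : 0 ≤ (v - t) ^ (-(a + 1)) := rpow_nonneg (by linarith [hv.1, ht.2]) _
      rw [norm_mul, Real.norm_of_nonneg (mul_nonneg hw hvt), norm_neg, Real.norm_eq_abs,
        mul_left_comm]
      exact mul_le_mul_of_nonneg_left (mul_le_mul_of_nonneg_left
        (rpow_le_add_of_mem_Icc (by linarith) (by linarith [hv.1, ht.2])
          (by linarith [hv.2, ht.1]) _) (abs_nonneg a)) hw)
    (integrableOn_gegenbauer_mul hμ continuousOn_const)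
    (by
      refine (ae_restrict_iff' measurableSet_Ioo).2 (ae_of_all _ fun t ht v hv => ?_)
      have hvt : v - t ≠ 0 := by linarith [hv.1, ht.2]
      refine ((((hasDerivAt_id v).sub_const t).rpow_const (p := -a)
        (Or.inl hvt)).const_mul _).congr_deriv ?_
      simp only [id]
      rw [show -a - 1 = -(a + 1) by ring]
      ring)).2
  rwa [integral_const_mul] at key

/-- Three-term contiguity relation for the kernels. -/
lemma gegenbauerKernel_contiguous {μ u : ℝ} (hμ : -1 / 2 < μ) (hu : 1 < u) (a : ℝ) :
    (a + 1) * (u ^ 2 - 1) * gegenbauerKernel μ (a + 2) u =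
      (2 * a + 1 - 2 * μ) * u * gegenbauerKernel μ (a + 1) u +
        (2 * μ - a) * gegenbauerKernel μ a u := by
  have key := integral_gegenbauer_by_parts hμ (f := fun t => (u - t) ^ (-(a + 1)))
    (f' := fun t => (a + 1) * (u - t) ^ (-(a + 2))) (fun t ht => by
      have hut : u - t ≠ 0 := by linarith [ht.2]
      refine (((hasDerivAt_id t).const_sub u).rpow_const (p := -(a + 1))
        (Or.inl hut)).congr_deriv ?_
      simp only [id]
      rw [show -(a + 1) - 1 = -(a + 2) by ring]
      ring) ((continuousOn_sub_rpow hu _).const_mul _)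
  have hi := integrableOn_gegenbauerKernel hμ hu
  have e : ∫ t in Set.Ioo (-1 : ℝ) 1, (1 - t ^ 2) ^ (μ - 1 / 2) *
      ((1 - t ^ 2) * ((a + 1) * (u - t) ^ (-(a + 2))) -
        (2 * μ + 1) * t * (u - t) ^ (-(a + 1))) =
      ∫ t in Set.Ioo (-1 : ℝ) 1,
        (((2 * a + 1 - 2 * μ) * u * ((1 - t ^ 2) ^ (μ - 1 / 2) * (u - t) ^ (-(a + 1))) +
          (2 * μ - a) * ((1 - t ^ 2) ^ (μ - 1 / 2) * (u - t) ^ (-a))) -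
          (a + 1) * (u ^ 2 - 1) * ((1 - t ^ 2) ^ (μ - 1 / 2) * (u - t) ^ (-(a + 2)))) := by
    refine setIntegral_congr_fun measurableSet_Ioo fun t ht => ?_
    have hut : u - t ≠ 0 := by linarith [ht.2]
    have e1 : (u - t) ^ (-(a + 1)) = (u - t) ^ (-(a + 2)) * (u - t) := by
      rw [← rpow_add_one hut]; ring_nf
    have e2 : (u - t) ^ (-a) = (u - t) ^ (-(a + 2)) * (u - t) * (u - t) := by
      rw [← e1, ← rpow_add_one hut]; ring_nf
    rw [e1, e2]
    ring
  have hadd : IntegrableOn (fun t : ℝ =>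
      (2 * a + 1 - 2 * μ) * u * ((1 - t ^ 2) ^ (μ - 1 / 2) * (u - t) ^ (-(a + 1))) +
        (2 * μ - a) * ((1 - t ^ 2) ^ (μ - 1 / 2) * (u - t) ^ (-a))) (Set.Ioo (-1) 1) :=
    Integrable.add ((hi _).const_mul _) ((hi _).const_mul _)
  rw [e, integral_sub hadd ((hi _).const_mul _),
    integral_add ((hi _).const_mul _) ((hi _).const_mul _), integral_const_mul,
    integral_const_mul, integral_const_mul] at key
  simp only [gegenbauerKernel]
  linarith

/-- Reflection formula, obtained from the involution `t ↦ (1 - u t) / (u - t)` of `(-1, 1)`. -/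
lemma gegenbauerKernel_reflection (μ a : ℝ) {u : ℝ} (hu : 1 < u) :
    (u ^ 2 - 1) ^ (a - μ - 1 / 2) * gegenbauerKernel μ a u =
      gegenbauerKernel μ (2 * μ + 1 - a) u := by
  set φ : ℝ → ℝ := fun t => (1 - u * t) / (u - t) with hφ
  have hu2 : 0 < u ^ 2 - 1 := by nlinarith
  have hut : ∀ t ∈ Set.Ioo (-1 : ℝ) 1, 0 < u - t := fun t ht => by linarith [ht.2]
  have hmaps : ∀ t ∈ Set.Ioo (-1 : ℝ) 1, φ t ∈ Set.Ioo (-1 : ℝ) 1 := fun t ht => by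
    have h := hut t ht
    constructor
    · rw [hφ, lt_div_iff₀ h]; nlinarith [ht.1, ht.2]
    · rw [hφ, div_lt_iff₀ h]; nlinarith [ht.1, ht.2]
  have hsub : ∀ t ∈ Set.Ioo (-1 : ℝ) 1, u - φ t = (u ^ 2 - 1) / (u - t) := fun t ht => by
    have h := (hut t ht).ne'
    simp only [hφ]
    field_simp
    ring
  have hinv : ∀ t ∈ Set.Ioo (-1 : ℝ) 1, φ (φ t) = t := fun t ht => by
    have h := (hut t ht).ne'
    have hd : φ (φ t) = (1 - u * φ t) / (u - φ t) := rfl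
    rw [hd, hsub t ht]
    simp only [hφ]
    field_simp
    ring
  have himage : Set.image φ (Set.Ioo (-1 : ℝ) 1) = Set.Ioo (-1 : ℝ) 1 := by
    ext t
    exact ⟨fun ⟨s, hs, h⟩ => h ▸ hmaps s hs, fun ht => ⟨φ t, hmaps t ht, hinv t ht⟩⟩
  have hinj : Set.InjOn φ (Set.Ioo (-1 : ℝ) 1) := fun s hs t ht h => by
    rw [← hinv s hs, h, hinv t ht]
  have hderiv : ∀ t ∈ Set.Ioo (-1 : ℝ) 1,
      HasDerivWithinAt φ (-((u ^ 2 - 1) / (u - t) ^ 2)) (Set.Ioo (-1) 1) t := fun t ht => by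
    have h := (hut t ht).ne'
    refine ((((hasDerivAt_id t).const_mul u).const_sub 1).div
      ((hasDerivAt_id t).const_sub u) h).hasDerivWithinAt.congr_deriv ?_
    simp only [id]
    field_simp
    ring
  have key := integral_image_eq_integral_abs_deriv_smul measurableSet_Ioo hderiv hinj
    (fun t => (1 - t ^ 2) ^ (μ - 1 / 2) * (u - t) ^ (-a))
  rw [himage] at key
  rw [gegenbauerKernel, key, gegenbauerKernel, ← integral_const_mul]
  refine setIntegral_congr_fun measurableSet_Ioo fun t ht => ?_
  have h := hut t ht
  have hw := one_sub_sq_pos ht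
  have e1 : 1 - φ t ^ 2 = (u ^ 2 - 1) * (1 - t ^ 2) * ((u - t) ^ (-2 : ℝ)) := by
    rw [rpow_neg h.le, rpow_two]
    simp only [hφ]
    field_simp
    ring
  have e2 : u - φ t = (u ^ 2 - 1) * (u - t) ^ (-1 : ℝ) := by
    rw [hsub t ht, rpow_neg_one, div_eq_mul_inv]
  have e3 : |-((u ^ 2 - 1) / (u - t) ^ 2)| = (u ^ 2 - 1) ^ (1 : ℝ) * (u - t) ^ (-2 : ℝ) := by
    rw [abs_neg, abs_of_pos (by positivity), rpow_neg h.le, rpow_two, rpow_one, div_eq_mul_inv]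
  simp only [smul_eq_mul]
  rw [e1, e2, e3, mul_rpow (by positivity) (by positivity), mul_rpow hu2.le hw.le,
    mul_rpow hu2.le (by positivity), ← rpow_mul h.le, ← rpow_mul h.le]
  have e4 : (u ^ 2 - 1) ^ (a - μ - 1 / 2) * ((u ^ 2 - 1) ^ (1 : ℝ) *
      ((u ^ 2 - 1) ^ (μ - 1 / 2) * (u ^ 2 - 1) ^ (-a))) = 1 := by
    rw [← rpow_add hu2, ← rpow_add hu2, ← rpow_add hu2]
    ring_nf
    exact rpow_zero _
  have e5 : (u - t) ^ (-2 : ℝ) * ((u - t) ^ (-2 * (μ - 1 / 2)) * (u - t) ^ (-1 * -a)) =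
      (u - t) ^ (-(2 * μ + 1 - a)) := by
    rw [← rpow_add h, ← rpow_add h]
    ring_nf
  rw [← e5]
  linear_combination (1 - t ^ 2) ^ (μ - 1 / 2) * ((u - t) ^ (-2 : ℝ) *
    ((u - t) ^ (-2 * (μ - 1 / 2)) * (u - t) ^ (-1 * -a))) * e4

lemma tendsto_gegenbauerKernel_one {μ a : ℝ} (hμ : -1 / 2 < μ) (ha : a < μ + 1 / 2) :
    Tendsto (gegenbauerKernel μ a) (nhdsWithin 1 (Set.Ioi 1))
      (nhds (2 ^ (2 * μ - a) * (Real.Gamma (μ + 1 / 2 - a) * Real.Gamma (μ + 1 / 2) /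
        Real.Gamma (2 * μ + 1 - a)))) := by
  have hp : 0 < μ + 1 / 2 - a := by linarith
  have hq : 0 < μ + 1 / 2 := by linarith
  have hpt : ∀ t ∈ Set.Ioo (-1 : ℝ) 1, (1 - t) ^ (μ + 1 / 2 - a - 1) *
      (1 + t) ^ (μ + 1 / 2 - 1) = (1 - t ^ 2) ^ (μ - 1 / 2) * (1 - t) ^ (-a) := fun t ht => by
    rw [one_sub_sq_rpow ht, show μ + 1 / 2 - a - 1 = (μ - 1 / 2) + -a by ring,
      rpow_add (by linarith [ht.2]), show μ + 1 / 2 - 1 = μ - 1 / 2 by ring]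
    ring
  have hval := integral_jacobi hp hq
  rw [setIntegral_congr_fun measurableSet_Ioo hpt,
    show μ + 1 / 2 - a + (μ + 1 / 2) = 2 * μ + 1 - a by ring,
    show 2 * μ + 1 - a - 1 = 2 * μ - a by ring] at hval
  have hint := (integrableOn_jacobi hp hq).congr_fun hpt measurableSet_Ioo
  rw [← hval]
  have hnear : ∀ᶠ u : ℝ in nhdsWithin 1 (Set.Ioi 1), u ∈ Set.Ioo (1 : ℝ) 2 :=
    Ioo_mem_nhdsGT one_lt_two
  refine tendsto_integral_filter_of_dominated_convergence
    (fun t => (1 - t ^ 2) ^ (μ - 1 / 2) * (1 - t) ^ (-a) +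
      (1 - t ^ 2) ^ (μ - 1 / 2) * 3 ^ (-a)) ?_ ?_
    (Integrable.add hint (integrableOn_gegenbauer_mul hμ continuousOn_const)) ?_
  · filter_upwards [hnear] with u hu
    exact (integrableOn_gegenbauerKernel hμ hu.1 a).aestronglyMeasurable
  · filter_upwards [hnear] with u hu
    refine (ae_restrict_iff' measurableSet_Ioo).2 (ae_of_all _ fun t ht => ?_)
    have hw := rpow_nonneg (one_sub_sq_pos ht).le (μ - 1 / 2)
    rw [Real.norm_of_nonneg (mul_nonneg hw (rpow_nonneg (by linarith [hu.1, ht.2]) _)),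
      ← mul_add]
    exact mul_le_mul_of_nonneg_left (rpow_le_add_of_mem_Icc (by linarith [ht.2])
      (by linarith [hu.1]) (by linarith [hu.2, ht.1]) _) hw
  · refine (ae_restrict_iff' measurableSet_Ioo).2 (ae_of_all _ fun t ht => ?_)
    have hc : ContinuousAt (fun u : ℝ => (u - t) ^ (-a)) 1 :=
      ContinuousAt.rpow_const (by fun_prop) (Or.inl (by linarith [ht.2]))
    exact (hc.tendsto.mono_left nhdsWithin_le_nhds).const_mul _

/-- The weighted Wronskian of two kernels, up to normalisation of the propagators. -/
noncomputable def kernelWronskian (d l n u : ℝ) : ℝ :=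
  (u ^ 2 - 1) ^ (d / 2) *
    (((d - 1) / 2 + n) * gegenbauerKernel l ((d - 1) / 2 + l) u *
        gegenbauerKernel n ((d - 1) / 2 + n + 1) u -
      ((d - 1) / 2 + l) * gegenbauerKernel l ((d - 1) / 2 + l + 1) u *
        gegenbauerKernel n ((d - 1) / 2 + n) u)

lemma hasDerivAt_kernelWronskian {d l n u : ℝ} (hl : -1 / 2 < l) (hn : -1 / 2 < n) (hu : 1 < u) :
    HasDerivAt (kernelWronskian d l n)
      ((l ^ 2 - n ^ 2) * (gegenbauerKernel l ((d - 1) / 2 + l) u *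
        gegenbauerKernel n ((d - 1) / 2 + n) u * (u ^ 2 - 1) ^ ((d - 2) / 2))) u := by
  have hu2 : 0 < u ^ 2 - 1 := by nlinarith
  have hw : HasDerivAt (fun u : ℝ => u ^ 2 - 1) (2 * u) u := by
    simpa using (hasDerivAt_pow 2 u).sub_const 1
  have hwp := hw.rpow_const (p := d / 2) (Or.inl hu2.ne')
  have hl0 := hasDerivAt_gegenbauerKernel hl hu ((d - 1) / 2 + l)
  have hl1 := hasDerivAt_gegenbauerKernel hl hu ((d - 1) / 2 + l + 1)
  have hn0 := hasDerivAt_gegenbauerKernel hn hu ((d - 1) / 2 + n)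
  have hn1 := hasDerivAt_gegenbauerKernel hn hu ((d - 1) / 2 + n + 1)
  have cl := gegenbauerKernel_contiguous hl hu ((d - 1) / 2 + l)
  have cn := gegenbauerKernel_contiguous hn hu ((d - 1) / 2 + n)
  refine (hwp.mul (((hl0.const_mul _).mul hn1).sub ((hl1.const_mul _).mul hn0))).congr_deriv ?_
  have e : (u ^ 2 - 1) ^ (d / 2) = (u ^ 2 - 1) ^ ((d - 2) / 2) * (u ^ 2 - 1) := by
    rw [← rpow_add_one hu2.ne']; ring_nf
  rw [e, show d / 2 - 1 = (d - 2) / 2 by ring,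
    show (d - 1) / 2 + l + 1 + 1 = (d - 1) / 2 + l + 2 by ring,
    show (d - 1) / 2 + n + 1 + 1 = (d - 1) / 2 + n + 2 by ring]
  simp only [Pi.mul_apply, Pi.sub_apply]
  linear_combination (u ^ 2 - 1) ^ ((d - 2) / 2) * ((d - 1) / 2 + l) *
    gegenbauerKernel n ((d - 1) / 2 + n) u * cl -
    (u ^ 2 - 1) ^ ((d - 2) / 2) * ((d - 1) / 2 + n) *
    gegenbauerKernel l ((d - 1) / 2 + l) u * cn

lemma tendsto_mul_gegenbauerKernel_mul_atTop {d l n : ℝ} (hd : 1 < d) (hl : 0 < l) (hn : 0 < n) :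
    Tendsto (fun u : ℝ => (u ^ 2 - 1) ^ (d / 2) *
      (gegenbauerKernel l ((d - 1) / 2 + l + 1) u * gegenbauerKernel n ((d - 1) / 2 + n) u))
      atTop (nhds 0) := by
  set Ml := ∫ t in Set.Ioo (-1 : ℝ) 1, (1 - t ^ 2) ^ (l - 1 / 2) with hMl
  set Mn := ∫ t in Set.Ioo (-1 : ℝ) 1, (1 - t ^ 2) ^ (n - 1 / 2) with hMn
  have hMl0 : 0 ≤ Ml := setIntegral_nonneg measurableSet_Ioo fun t ht =>
    rpow_nonneg (one_sub_sq_pos ht).le _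
  have hlim : Tendsto (fun u : ℝ => 2 ^ (d / 2) * (Ml * Mn) * (u - 1) ^ (-(l + n)))
      atTop (nhds 0) := by
    simpa [sub_eq_add_neg] using ((tendsto_rpow_neg_atTop (add_pos hl hn)).comp
      (tendsto_atTop_add_const_right atTop (-1 : ℝ) tendsto_id)).const_mul
      (2 ^ (d / 2) * (Ml * Mn))
  refine squeeze_zero' ?_ ?_ hlim
  · filter_upwards [eventually_gt_atTop 1] with u hu
    exact mul_nonneg (rpow_nonneg (by nlinarith) _)
      (mul_nonneg (gegenbauerKernel_nonneg _ _ hu) (gegenbauerKernel_nonneg _ _ hu))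
  · filter_upwards [eventually_ge_atTop 3] with u hu
    have h1 : 0 < u - 1 := by linarith
    have hw : (u ^ 2 - 1) ^ (d / 2) ≤ 2 ^ (d / 2) * (u - 1) ^ d := by
      calc (u ^ 2 - 1) ^ (d / 2) ≤ (2 * (u - 1) ^ (2 : ℝ)) ^ (d / 2) := by
            refine rpow_le_rpow (by nlinarith) ?_ (by linarith)
            rw [rpow_two]
            nlinarith
        _ = 2 ^ (d / 2) * (u - 1) ^ d := by
            rw [mul_rpow two_pos.le (by positivity), ← rpow_mul h1.le, mul_div_cancel₀ d two_ne_zero]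
    have kl := gegenbauerKernel_le (μ := l) (a := (d - 1) / 2 + l + 1) (u := u) (by linarith)
      (by linarith) (by linarith)
    have kn := gegenbauerKernel_le (μ := n) (a := (d - 1) / 2 + n) (u := u) (by linarith)
      (by linarith) (by linarith)
    calc _ ≤ 2 ^ (d / 2) * (u - 1) ^ d * ((Ml * (u - 1) ^ (-((d - 1) / 2 + l + 1))) *
          (Mn * (u - 1) ^ (-((d - 1) / 2 + n)))) :=
          mul_le_mul hw (mul_le_mul kl kn (gegenbauerKernel_nonneg _ _ (by linarith))
            (by positivity)) (mul_nonneg (gegenbauerKernel_nonneg _ _ (by linarith))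
            (gegenbauerKernel_nonneg _ _ (by linarith))) (by positivity)
      _ = 2 ^ (d / 2) * (Ml * Mn) * ((u - 1) ^ d * (u - 1) ^ (-((d - 1) / 2 + l + 1)) *
          (u - 1) ^ (-((d - 1) / 2 + n))) := by ring
      _ = _ := by
          rw [← rpow_add h1, ← rpow_add h1]
          ring_nf

lemma tendsto_kernelWronskian_atTop {d l n : ℝ} (hd : 1 < d) (hl : 0 < l) (hn : 0 < n) :
    Tendsto (kernelWronskian d l n) atTop (nhds 0) := by
  have h := ((tendsto_mul_gegenbauerKernel_mul_atTop hd hn hl).const_mul ((d - 1) / 2 + n)).sub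
    ((tendsto_mul_gegenbauerKernel_mul_atTop hd hl hn).const_mul ((d - 1) / 2 + l))
  simp only [mul_zero, sub_zero] at h
  refine h.congr fun u => ?_
  rw [kernelWronskian]
  ring

/-- The factor relating the propagator to `gegenbauerKernel`. -/
noncomputable def adsGNorm (d μ : ℝ) : ℝ :=
  Real.Gamma ((d - 1) / 2 + μ) /
    (2 ^ ((d - 1) / 2 + μ + 1) * π ^ (d / 2) * Real.Gamma (μ + 1 / 2))

lemma tendsto_normalized_kernel_of_lt_two {d l n : ℝ} (hd1 : 1 < d) (hd2 : d < 2) (hl : 0 < l)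
    (hn : 0 < n) :
    Tendsto (fun u : ℝ => adsGNorm d l * adsGNorm d n * ((u ^ 2 - 1) ^ (d / 2) *
      (((d - 1) / 2 + l) * gegenbauerKernel l ((d - 1) / 2 + l + 1) u *
        gegenbauerKernel n ((d - 1) / 2 + n) u))) (nhdsWithin 1 (Set.Ioi 1))
      (nhds (Real.Gamma (d / 2) * Real.Gamma (1 - d / 2) / (2 * 2 ^ d * (π ^ (d / 2)) ^ 2) *
        (Real.Gamma ((d - 1) / 2 + n) / Real.Gamma ((3 - d) / 2 + n)))) := by
  have tl := tendsto_gegenbauerKernel_one (μ := l) (a := l - (d - 1) / 2) (by linarith)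
    (by linarith)
  have tn := tendsto_gegenbauerKernel_one (μ := n) (a := (d - 1) / 2 + n) (by linarith)
    (by linarith)
  refine (((tl.mul tn).const_mul (adsGNorm d l * adsGNorm d n * ((d - 1) / 2 + l))).congr' ?_).trans
    (le_of_eq (congrArg nhds ?_))
  · filter_upwards [self_mem_nhdsWithin] with u hu
    have hr := gegenbauerKernel_reflection l ((d - 1) / 2 + l + 1) hu
    rw [show (d - 1) / 2 + l + 1 - l - 1 / 2 = d / 2 by ring,
      show 2 * l + 1 - ((d - 1) / 2 + l + 1) = l - (d - 1) / 2 by ring] at hr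
    rw [← hr]
    ring
  · have ha : 0 < (d - 1) / 2 + l := by linarith
    have g1 := (Real.Gamma_pos_of_pos ha).ne'
    have g2 := (Real.Gamma_pos_of_pos (show 0 < l + 1 / 2 by linarith)).ne'
    have g3 := (Real.Gamma_pos_of_pos (show 0 < n + 1 / 2 by linarith)).ne'
    have g4 := (Real.Gamma_pos_of_pos (show 0 < (3 - d) / 2 + n by linarith)).ne'
    rw [adsGNorm, adsGNorm, show l + 1 / 2 - (l - (d - 1) / 2) = d / 2 by ring,
      show n + 1 / 2 - ((d - 1) / 2 + n) = 1 - d / 2 by ring,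
      show 2 * l + 1 - (l - (d - 1) / 2) = (d - 1) / 2 + l + 1 by ring,
      show 2 * n + 1 - ((d - 1) / 2 + n) = (3 - d) / 2 + n by ring,
      Real.Gamma_add_one ha.ne',
      show 2 * l - (l - (d - 1) / 2) = (d - 1) / 2 + l by ring, rpow_add_one two_ne_zero,
      show (d - 1) / 2 + n + 1 = (2 * n - ((d - 1) / 2 + n)) + d by ring,
      rpow_add two_pos (2 * n - ((d - 1) / 2 + n)) d]
    have ha' := ha.ne'
    generalize Real.Gamma ((d - 1) / 2 + l) = A at *
    generalize Real.Gamma ((d - 1) / 2 + n) = B at *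
    generalize Real.Gamma ((3 - d) / 2 + n) = C at *
    generalize Real.Gamma (1 - d / 2) = D at *
    generalize (d - 1) / 2 + l = a at *
    have hp : (2 : ℝ) ^ (2 * n - ((d - 1) / 2 + n)) ≠ 0 := by positivity
    generalize (2 : ℝ) ^ (2 * n - ((d - 1) / 2 + n)) = P at *
    field_simp

lemma tendsto_normalized_kernel_of_two_lt {d l n : ℝ} (hd2 : 2 < d) (hd4 : d < 4) (hl : 0 < l)
    (hn : 0 < n) :
    Tendsto (fun u : ℝ => adsGNorm d l * adsGNorm d n *
      (((3 - d) / 2 + l) * gegenbauerKernel l ((d - 1) / 2 + l - 1) u *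
        gegenbauerKernel n ((3 - d) / 2 + n) u)) (nhdsWithin 1 (Set.Ioi 1))
      (nhds (-(Real.Gamma (d / 2) * Real.Gamma (1 - d / 2) / (2 * 2 ^ d * (π ^ (d / 2)) ^ 2) *
        (Real.Gamma ((d - 1) / 2 + l) / Real.Gamma ((3 - d) / 2 + l))))) := by
  have tl := tendsto_gegenbauerKernel_one (μ := l) (a := (d - 1) / 2 + l - 1) (by linarith)
    (by linarith)
  have tn := tendsto_gegenbauerKernel_one (μ := n) (a := (3 - d) / 2 + n) (by linarith)
    (by linarith)
  refine (((tl.mul tn).const_mul (adsGNorm d l * adsGNorm d n * ((3 - d) / 2 + l))).congr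
    fun u => by ring).trans (le_of_eq (congrArg nhds ?_))
  rcases eq_or_ne ((3 - d) / 2 + l) 0 with h0 | h0
  · simp [h0, Real.Gamma_zero]
  · have g1 := (Real.Gamma_pos_of_pos (show 0 < (d - 1) / 2 + n by linarith)).ne'
    have g2 := (Real.Gamma_pos_of_pos (show 0 < l + 1 / 2 by linarith)).ne'
    have g3 := (Real.Gamma_pos_of_pos (show 0 < n + 1 / 2 by linarith)).ne'
    have g4 : Real.Gamma ((3 - d) / 2 + l) ≠ 0 := by
      have h := (Real.Gamma_pos_of_pos (show 0 < (3 - d) / 2 + l + 1 by linarith)).ne'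
      rw [Real.Gamma_add_one h0] at h
      exact right_ne_zero_of_mul h
    have hd : 1 - d / 2 ≠ 0 := by linarith
    have hd' : d / 2 - 1 ≠ 0 := by linarith
    have hG : Real.Gamma (2 - d / 2) = (1 - d / 2) * Real.Gamma (1 - d / 2) := by
      rw [← Real.Gamma_add_one hd]; ring_nf
    have hG' : Real.Gamma (d / 2) = (d / 2 - 1) * Real.Gamma (d / 2 - 1) := by
      rw [← Real.Gamma_add_one hd']; ring_nf
    rw [adsGNorm, adsGNorm, show l + 1 / 2 - ((d - 1) / 2 + l - 1) = 2 - d / 2 by ring,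
      show n + 1 / 2 - ((3 - d) / 2 + n) = d / 2 - 1 by ring,
      show 2 * l + 1 - ((d - 1) / 2 + l - 1) = (3 - d) / 2 + l + 1 by ring,
      show 2 * n + 1 - ((3 - d) / 2 + n) = (d - 1) / 2 + n by ring,
      Real.Gamma_add_one h0, hG, hG',
      show (d - 1) / 2 + l + 1 = (2 * l - ((d - 1) / 2 + l - 1)) + d - 1 by ring,
      show (d - 1) / 2 + n + 1 = (2 * n - ((3 - d) / 2 + n)) + 1 + 1 by ring,
      rpow_sub_one two_ne_zero, rpow_add two_pos _ d, rpow_add_one two_ne_zero,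
      rpow_add_one two_ne_zero]
    have hp : (2 : ℝ) ^ (2 * l - ((d - 1) / 2 + l - 1)) ≠ 0 := by positivity
    have hq : (2 : ℝ) ^ (2 * n - ((3 - d) / 2 + n)) ≠ 0 := by positivity
    generalize (2 : ℝ) ^ (2 * l - ((d - 1) / 2 + l - 1)) = P at *
    generalize (2 : ℝ) ^ (2 * n - ((3 - d) / 2 + n)) = Q at *
    generalize Real.Gamma ((d - 1) / 2 + l) = A at *
    generalize Real.Gamma ((d - 1) / 2 + n) = B at *
    generalize Real.Gamma ((3 - d) / 2 + l) = C at *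
    generalize Real.Gamma (1 - d / 2) = D at *
    generalize Real.Gamma (d / 2 - 1) = E at *
    generalize (3 - d) / 2 + l = a at *
    field_simp
    ring

lemma tendsto_kernelWronskian_one {d l n : ℝ} (hd1 : 1 < d) (hd4 : d < 4) (hd2 : d ≠ 2)
    (hl : 0 < l) (hn : 0 < n) :
    Tendsto (fun u => adsGNorm d l * adsGNorm d n * kernelWronskian d l n u)
      (nhdsWithin 1 (Set.Ioi 1))
      (nhds (Real.Gamma (d / 2) * Real.Gamma (1 - d / 2) / (2 * 2 ^ d * (π ^ (d / 2)) ^ 2) *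
        (Real.Gamma ((d - 1) / 2 + l) / Real.Gamma ((3 - d) / 2 + l) -
          Real.Gamma ((d - 1) / 2 + n) / Real.Gamma ((3 - d) / 2 + n)))) := by
  rcases lt_or_gt_of_ne hd2 with h | h
  · have t := (tendsto_normalized_kernel_of_lt_two hd1 h hn hl).sub
      (tendsto_normalized_kernel_of_lt_two hd1 h hl hn)
    rw [← mul_sub] at t
    refine t.congr fun u => ?_
    rw [kernelWronskian]
    ring
  · have t := (tendsto_normalized_kernel_of_two_lt h hd4 hn hl).sub
      (tendsto_normalized_kernel_of_two_lt h hd4 hl hn)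
    rw [neg_sub_neg, ← mul_sub] at t
    refine t.congr' ?_
    filter_upwards [self_mem_nhdsWithin] with u hu
    have hu2 : 0 < u ^ 2 - 1 := by nlinarith [Set.mem_Ioi.1 hu]
    have e : (u ^ 2 - 1) ^ (d / 2) = (u ^ 2 - 1) ^ ((d - 2) / 2) * (u ^ 2 - 1) := by
      rw [← rpow_add_one hu2.ne']; ring_nf
    have hrefl : ∀ μ : ℝ, gegenbauerKernel μ ((3 - d) / 2 + μ) u =
        (u ^ 2 - 1) ^ ((d - 2) / 2) * gegenbauerKernel μ ((d - 1) / 2 + μ) u := fun μ => by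
      have hr := gegenbauerKernel_reflection μ ((d - 1) / 2 + μ) hu
      rw [show 2 * μ + 1 - ((d - 1) / 2 + μ) = (3 - d) / 2 + μ by ring,
        show (d - 1) / 2 + μ - μ - 1 / 2 = (d - 2) / 2 by ring] at hr
      exact hr.symm
    have hcontig : ∀ μ : ℝ, 0 < μ →
        ((d - 1) / 2 + μ) * (u ^ 2 - 1) * gegenbauerKernel μ ((d - 1) / 2 + μ + 1) u =
          (d - 2) * u * gegenbauerKernel μ ((d - 1) / 2 + μ) u +
            ((3 - d) / 2 + μ) * gegenbauerKernel μ ((d - 1) / 2 + μ - 1) u := fun μ hμ => by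
      have hc := gegenbauerKernel_contiguous (μ := μ) (by linarith) hu ((d - 1) / 2 + μ - 1)
      rw [show (d - 1) / 2 + μ - 1 + 2 = (d - 1) / 2 + μ + 1 by ring, sub_add_cancel] at hc
      linear_combination hc
    rw [kernelWronskian, hrefl, hrefl, e]
    linear_combination adsGNorm d l * adsGNorm d n * (u ^ 2 - 1) ^ ((d - 2) / 2) *
      (gegenbauerKernel n ((d - 1) / 2 + n) u * hcontig l hl -
        gegenbauerKernel l ((d - 1) / 2 + l) u * hcontig n hn)

/-- One-loop bubble integral on Euclidean AdS with two independent masses. -/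
theorem one_loop_bubble (d lam nu : ℝ) (hd1 : 1 < d) (hd4 : d < 4) (hd2 : d ≠ 2)
    (hlam : 0 < lam) (hnu : 0 < nu) (hne : lam ≠ nu) :
    IntegrableOn
      (fun u : ℝ => adsG d lam u * adsG d nu u * (u ^ 2 - 1) ^ ((d - 2) / 2)) (Set.Ioi 1) ∧
    (2 * Real.pi ^ (d / 2) / Real.Gamma (d / 2)) *
        ∫ u in Set.Ioi (1 : ℝ), adsG d lam u * adsG d nu u * (u ^ 2 - 1) ^ ((d - 2) / 2) =
      Real.Gamma (1 - d / 2) / (2 ^ d * Real.pi ^ (d / 2) * (lam ^ 2 - nu ^ 2)) *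
        (Real.Gamma ((d - 1) / 2 + nu) / Real.Gamma ((3 - d) / 2 + nu) -
          Real.Gamma ((d - 1) / 2 + lam) / Real.Gamma ((3 - d) / 2 + lam)) := by
  have hsq : lam ^ 2 - nu ^ 2 ≠ 0 := by
    rw [sq_sub_sq]
    exact mul_ne_zero (by positivity) (sub_ne_zero.2 hne)
  set g : ℝ → ℝ := fun u => (lam ^ 2 - nu ^ 2)⁻¹ *
    (adsGNorm d lam * adsGNorm d nu * kernelWronskian d lam nu u)
  set L : ℝ := (lam ^ 2 - nu ^ 2)⁻¹ *
    (Real.Gamma (d / 2) * Real.Gamma (1 - d / 2) / (2 * 2 ^ d * (π ^ (d / 2)) ^ 2) *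
      (Real.Gamma ((d - 1) / 2 + lam) / Real.Gamma ((3 - d) / 2 + lam) -
        Real.Gamma ((d - 1) / 2 + nu) / Real.Gamma ((3 - d) / 2 + nu))) with hL
  have hcont : ContinuousWithinAt (Function.update g 1 L) (Set.Ici 1) 1 := by
    rw [continuousWithinAt_update_same, Set.Ici_sdiff_left]
    exact (tendsto_kernelWronskian_one hd1 hd4 hd2 hlam hnu).const_mul _
  have hderiv : ∀ u ∈ Set.Ioi (1 : ℝ), HasDerivAt (Function.update g 1 L)
      (adsG d lam u * adsG d nu u * (u ^ 2 - 1) ^ ((d - 2) / 2)) u := fun u hu => by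
    have hev : Function.update g 1 L =ᶠ[nhds u] g := by
      filter_upwards [isOpen_Ioi.mem_nhds hu] with v hv
      exact Function.update_of_ne (ne_of_gt hv) _ _
    refine ((((hasDerivAt_kernelWronskian (by linarith) (by linarith) hu).const_mul
      _).const_mul _).congr_of_eventuallyEq hev).congr_deriv ?_
    rw [adsG_eq_gegenbauerKernel hd1 hlam hu, adsG_eq_gegenbauerKernel hd1 hnu hu,
      ← adsGNorm, ← adsGNorm]
    field_simp
  have hpos : ∀ u ∈ Set.Ioi (1 : ℝ),
      0 ≤ adsG d lam u * adsG d nu u * (u ^ 2 - 1) ^ ((d - 2) / 2) := fun u hu => by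
    have hG : ∀ μ : ℝ, 0 < μ → 0 ≤ adsG d μ u := fun μ hμ => by
      rw [adsG_eq_gegenbauerKernel hd1 hμ hu]
      have h1 := Real.Gamma_pos_of_pos (show 0 < (d - 1) / 2 + μ by linarith)
      have h2 := Real.Gamma_pos_of_pos (show 0 < μ + 1 / 2 by linarith)
      exact mul_nonneg (by positivity) (gegenbauerKernel_nonneg _ _ hu)
    exact mul_nonneg (mul_nonneg (hG _ hlam) (hG _ hnu))
      (rpow_nonneg (by nlinarith [Set.mem_Ioi.1 hu]) _)
  have htop : Tendsto (Function.update g 1 L) atTop (nhds 0) := by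
    have h := ((tendsto_kernelWronskian_atTop hd1 hlam hnu).const_mul
      (adsGNorm d lam * adsGNorm d nu)).const_mul (lam ^ 2 - nu ^ 2)⁻¹
    rw [mul_zero, mul_zero] at h
    refine h.congr' ?_
    filter_upwards [eventually_gt_atTop 1] with v hv
    exact (Function.update_of_ne (ne_of_gt hv) L g).symm
  refine ⟨integrableOn_Ioi_deriv_of_nonneg hcont hderiv hpos htop, ?_⟩
  rw [integral_Ioi_of_hasDerivAt_of_nonneg hcont hderiv hpos htop, Function.update_self, hL]
  have g1 := (Real.Gamma_pos_of_pos (show 0 < d / 2 by linarith)).ne'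
  rw [← neg_sub (Real.Gamma ((d - 1) / 2 + nu) / Real.Gamma ((3 - d) / 2 + nu))]
  generalize Real.Gamma ((d - 1) / 2 + nu) / Real.Gamma ((3 - d) / 2 + nu) -
    Real.Gamma ((d - 1) / 2 + lam) / Real.Gamma ((3 - d) / 2 + lam) = R
  field_simp
  ring
end

section
/- Let d ≥ 1 be real and let ν be real with ν > (d−1)/2. Then the zero-loop integral converges and (2·π^(d/2)/Γ(d/2)) · ∫₁^∞ G(d,ν,u)·(u²−1)^((d−2)/2) du = 1/(ν² − ((d−1)/2)²). -/
open MeasureTheory Real Filter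

/-- The real Beta integral in terms of the Gamma function. -/
lemma integral_Ioo_rpow_mul_one_sub_rpow {α β : ℝ} (hα : 0 < α) (hβ : 0 < β) :
    ∫ x in Set.Ioo (0 : ℝ) 1, x ^ (α - 1) * (1 - x) ^ (β - 1) =
      Gamma α * Gamma β / Gamma (α + β) := by
  have hB := ProbabilityTheory.beta_pos hα hβ
  have hpdf := ProbabilityTheory.lintegral_betaPDF_eq_one hα hβ
  have hnonneg : ∀ x ∈ Set.Ioo (0 : ℝ) 1,
      0 ≤ 1 / ProbabilityTheory.beta α β * x ^ (α - 1) * (1 - x) ^ (β - 1) := fun x hx =>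
    mul_nonneg (mul_nonneg (one_div_nonneg.2 hB.le) (rpow_nonneg hx.1.le _))
      (rpow_nonneg (sub_nonneg.2 hx.2.le) _)
  rw [ProbabilityTheory.lintegral_betaPDF, ← ENNReal.toReal_eq_one_iff,
    ← integral_eq_lintegral_of_nonneg_ae
      (ae_restrict_of_forall_mem measurableSet_Ioo hnonneg)
      (Measurable.aestronglyMeasurable (by fun_prop))] at hpdf
  simp_rw [mul_assoc, integral_const_mul] at hpdf
  rw [one_div, inv_mul_eq_one₀ hB.ne'] at hpdf
  exact hpdf.symm

lemma integral_Ioi_one_rpow_mul_sq_sub_one_rpow {α β : ℝ} (hα : 0 < α) (hβ : 0 < β) :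
    ∫ u in Set.Ioi (1 : ℝ), u ^ (-(2 * α + 2 * β - 1)) * (u ^ 2 - 1) ^ (β - 1) =
      Gamma α * Gamma β / Gamma (α + β) / 2 := by
  have himage : (fun t : ℝ => t ^ (-(1 / 2) : ℝ)) '' Set.Ioo 0 1 = Set.Ioi 1 := by
    ext u
    constructor
    · rintro ⟨t, ht, rfl⟩
      exact one_lt_rpow_of_pos_of_lt_one_of_neg ht.1 ht.2 (by norm_num)
    · intro hu
      have hu : 1 < u := hu
      refine ⟨u ^ (-2 : ℝ), ⟨by positivity, rpow_lt_one_of_one_lt_of_neg hu (by norm_num)⟩, ?_⟩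
      simp only
      rw [← rpow_mul (by positivity)]
      norm_num
  have hderiv : ∀ t ∈ Set.Ioo (0 : ℝ) 1, HasDerivWithinAt (fun t : ℝ => t ^ (-(1 / 2) : ℝ))
      (-(1 / 2) * t ^ (-(1 / 2) - 1 : ℝ)) (Set.Ioo 0 1) t := fun t ht =>
    (hasDerivAt_rpow_const (Or.inl ht.1.ne')).hasDerivWithinAt
  have hinj : Set.InjOn (fun t : ℝ => t ^ (-(1 / 2) : ℝ)) (Set.Ioo 0 1) := fun s hs t ht h =>
    (rpow_left_inj hs.1.le ht.1.le (by norm_num)).1 h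
  rw [← himage, integral_image_eq_integral_abs_deriv_smul measurableSet_Ioo hderiv hinj,
    ← integral_Ioo_rpow_mul_one_sub_rpow hα hβ, ← integral_div]
  refine setIntegral_congr_fun measurableSet_Ioo fun t ht => ?_
  have ht0 : 0 < t := ht.1
  have hsub : (t ^ (-(1 / 2) : ℝ)) ^ 2 - 1 = (1 - t) * t ^ (-1 : ℝ) := by
    rw [← rpow_natCast, ← rpow_mul ht0.le]
    norm_num [rpow_neg_one]
    field_simp
  simp only [smul_eq_mul]
  rw [hsub, mul_rpow (sub_nonneg.2 ht.2.le) (by positivity), ← rpow_mul ht0.le, ← rpow_mul ht0.le,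
    abs_mul, abs_of_nonneg (rpow_nonneg ht0.le _), abs_of_neg (by norm_num),
    show α - 1 = (-(1 / 2) - 1) + -(1 / 2) * -(2 * α + 2 * β - 1) + -1 * (β - 1) by ring,
    rpow_add ht0, rpow_add ht0]
  ring

lemma ascPochhammer_succ_eval_left (n : ℕ) (x : ℝ) :
    (ascPochhammer ℝ (n + 1)).eval x = x * (ascPochhammer ℝ n).eval (x + 1) := by
  simp [ascPochhammer_succ_left]

lemma ascPochhammer_eval_eq_prod_range_add (n : ℕ) (x : ℝ) :
    (ascPochhammer ℝ n).eval x = ∏ j ∈ Finset.range n, (x + j) := by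
  induction n with
  | zero => simp
  | succ n ih => rw [ascPochhammer_succ_eval, ih, Finset.prod_range_succ]

lemma Gamma_add_natCast_eq_ascPochhammer_mul {x : ℝ} (hx : 0 < x) (n : ℕ) :
    Gamma (x + n) = (ascPochhammer ℝ n).eval x * Gamma x := by
  induction n with
  | zero => simp
  | succ n ih =>
    rw [Nat.cast_succ, ← add_assoc, Gamma_add_one (by positivity), ih, ascPochhammer_succ_eval]
    ring

lemma sum_range_hypergeometric_one {a c : ℝ} (ha : 0 < a) (hc : 0 < c) (N : ℕ) :
    ∑ n ∈ Finset.range (N + 1), (ascPochhammer ℝ n).eval a * (ascPochhammer ℝ n).eval c /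
        ((ascPochhammer ℝ n).eval (a + c + 1) * (n.factorial : ℝ)) =
      (a + c) / (a * c) * ((ascPochhammer ℝ (N + 1)).eval a * (ascPochhammer ℝ (N + 1)).eval c /
        ((ascPochhammer ℝ (N + 1)).eval (a + c) * (N.factorial : ℝ))) := by
  induction N with
  | zero =>
    simp
    field_simp
  | succ N ih =>
    have hA := ascPochhammer_succ_eval_left (N + 1) (a + c)
    have hpos := ascPochhammer_pos (N + 1) (a + c) (by positivity)
    have hpos' := ascPochhammer_pos (N + 1) (a + c + 1) (by positivity)
    rw [Finset.sum_range_succ, ih, hA, ascPochhammer_succ_eval (N + 1) a,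
      ascPochhammer_succ_eval (N + 1) c, Nat.factorial_succ]
    rw [ascPochhammer_succ_eval] at hA
    have hA' : (ascPochhammer ℝ (N + 1)).eval (a + c + 1) =
        (ascPochhammer ℝ (N + 1)).eval (a + c) * (a + c + (N + 1 : ℕ)) / (a + c) := by
      rw [hA]
      field_simp
    rw [hA']
    push_cast
    field_simp
    ring

/-- The Gauss summation theorem for `₂F₁(a, c; a + c + 1; 1)`. -/
lemma hasSum_hypergeometric_one {a c : ℝ} (ha : 0 < a) (hc : 0 < c) :
    HasSum (fun n : ℕ => (ascPochhammer ℝ n).eval a * (ascPochhammer ℝ n).eval c /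
        ((ascPochhammer ℝ n).eval (a + c + 1) * (n.factorial : ℝ)))
      (Gamma (a + c + 1) / (Gamma (a + 1) * Gamma (c + 1))) := by
  have hnonneg : ∀ n : ℕ, 0 ≤ (ascPochhammer ℝ n).eval a * (ascPochhammer ℝ n).eval c /
      ((ascPochhammer ℝ n).eval (a + c + 1) * (n.factorial : ℝ)) := fun n => by
    have h₁ := ascPochhammer_pos n a ha
    have h₂ := ascPochhammer_pos n c hc
    have h₃ := ascPochhammer_pos n (a + c + 1) (by positivity)
    positivity
  rw [hasSum_iff_tendsto_nat_of_nonneg hnonneg, ← tendsto_add_atTop_iff_nat 1]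
  have hlim := ((GammaSeq_tendsto_Gamma (a + c)).div
    ((GammaSeq_tendsto_Gamma a).mul (GammaSeq_tendsto_Gamma c))
    (mul_pos (Gamma_pos_of_pos ha) (Gamma_pos_of_pos hc)).ne').const_mul ((a + c) / (a * c))
  rw [Gamma_add_one ha.ne', Gamma_add_one hc.ne', Gamma_add_one (by positivity)]
  convert! hlim.congr' ?_ using 2
  · have := Gamma_pos_of_pos ha
    have := Gamma_pos_of_pos hc
    field_simp
  · filter_upwards [eventually_gt_atTop 0] with N hN
    have hN' : (0 : ℝ) < N := Nat.cast_pos.2 hN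
    have h₁ := ascPochhammer_pos (N + 1) a ha
    have h₂ := ascPochhammer_pos (N + 1) c hc
    have h₃ := ascPochhammer_pos (N + 1) (a + c) (by positivity)
    rw [sum_range_hypergeometric_one ha hc]
    simp only [Pi.div_apply, GammaSeq, ← ascPochhammer_eval_eq_prod_range_add, rpow_add hN']
    field_simp

/-- The zero-loop integral on Euclidean AdS, evaluated by integrating the series termwise. -/
lemma integral_adsG_mul_sq_sub_one_rpow {d nu : ℝ} (hd : 1 ≤ d) (hnu : (d - 1) / 2 < nu) :
    ∫ u in Set.Ioi (1 : ℝ), adsG d nu u * (u ^ 2 - 1) ^ ((d - 2) / 2) =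
      Gamma (d / 2) / (2 * π ^ (d / 2)) * (1 / (nu ^ 2 - ((d - 1) / 2) ^ 2)) := by
  obtain ⟨a, ha⟩ : ∃ a, a = (d - 1) / 4 + nu / 2 := ⟨_, rfl⟩
  obtain ⟨c, hc⟩ : ∃ c, c = nu / 2 - (d - 1) / 4 := ⟨_, rfl⟩
  obtain ⟨b, hb⟩ : ∃ b, b = a + 1 / 2 := ⟨_, rfl⟩
  have ha0 : 0 < a := by linarith
  have hc0 : 0 < c := by linarith
  have hd0 : 0 < d / 2 := by linarith
  have hb0 : 0 < b := by linarith
  have hGa := Gamma_pos_of_pos ha0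
  have hGc := Gamma_pos_of_pos hc0
  have hGd := Gamma_pos_of_pos hd0
  have hGb := Gamma_pos_of_pos hb0
  have hG2a := Gamma_pos_of_pos (mul_pos two_pos ha0)
  have hGnu := Gamma_pos_of_pos (show 0 < a + c + 1 by positivity)
  obtain ⟨K, hK⟩ : ∃ K, K = Gamma (2 * a) /
      (2 * π ^ ((d - 1) / 2) * Gamma (a + c + 1) * 2 ^ (2 * a)) := ⟨_, rfl⟩
  have hK0 : 0 < K := by rw [hK]; positivity
  let A : ℕ → ℝ := fun n => (ascPochhammer ℝ n).eval a * (ascPochhammer ℝ n).eval b /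
    ((ascPochhammer ℝ n).eval (a + c + 1) * (n.factorial : ℝ))
  have hA0 : ∀ n, 0 < A n := fun n => by
    have h₁ := ascPochhammer_pos n a ha0
    have h₂ := ascPochhammer_pos n b hb0
    have h₃ := ascPochhammer_pos n (a + c + 1) (by positivity)
    positivity
  let F : ℕ → ℝ → ℝ := fun n u => K * A n *
    (u ^ (-(2 * (c + n) + 2 * (d / 2) - 1)) * (u ^ 2 - 1) ^ (d / 2 - 1))
  have hF : ∀ n, ∫ u in Set.Ioi (1 : ℝ), F n u =
      K * A n * (Gamma (c + n) * Gamma (d / 2) / Gamma (c + n + d / 2) / 2) := fun n => by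
    rw [integral_const_mul, integral_Ioi_one_rpow_mul_sq_sub_one_rpow (by positivity) hd0]
  have hF_pos : ∀ n, 0 < ∫ u in Set.Ioi (1 : ℝ), F n u := fun n => by
    have h₁ := Gamma_pos_of_pos (show 0 < c + n by positivity)
    have h₂ := Gamma_pos_of_pos (show 0 < c + n + d / 2 by positivity)
    have h₃ := hA0 n
    rw [hF]
    positivity
  have hF_nonneg : ∀ n, ∀ u ∈ Set.Ioi (1 : ℝ), 0 ≤ F n u := fun n u hu => by
    have hu : 1 < u := hu
    have h₁ := hA0 n
    have h₂ : 0 ≤ u ^ 2 - 1 := by nlinarith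
    positivity
  have hsum : HasSum (fun n => ∫ u in Set.Ioi (1 : ℝ), F n u)
      (K * Gamma (d / 2) * Gamma c / (2 * Gamma b) *
        (Gamma (a + c + 1) / (Gamma (a + 1) * Gamma (c + 1)))) := by
    refine ((hasSum_hypergeometric_one ha0 hc0).mul_left _).congr_fun fun n => ?_
    have h₁ := ascPochhammer_pos n b hb0
    have h₂ := ascPochhammer_pos n (a + c + 1) (by positivity)
    rw [hF, show c + n + d / 2 = b + n by rw [hb, ha, hc]; ring,
      Gamma_add_natCast_eq_ascPochhammer_mul hc0, Gamma_add_natCast_eq_ascPochhammer_mul hb0]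
    simp only [A]
    field_simp
  have hnorm : ∀ n, ∫ u in Set.Ioi (1 : ℝ), ‖F n u‖ = ∫ u in Set.Ioi (1 : ℝ), F n u := fun n =>
    setIntegral_congr_fun measurableSet_Ioi fun u hu => norm_of_nonneg (hF_nonneg n u hu)
  have hseries : ∫ u in Set.Ioi (1 : ℝ), adsG d nu u * (u ^ 2 - 1) ^ ((d - 2) / 2) =
      ∫ u in Set.Ioi (1 : ℝ), ∑' n, F n u := by
    refine setIntegral_congr_fun measurableSet_Ioi fun u hu => ?_
    have hu0 : 0 < u := zero_lt_one.trans hu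
    simp only [adsG]
    rw [show (d - 1) / 2 + nu = 2 * a by rw [ha]; ring, ← ha,
      show (d + 1) / 4 + nu / 2 = b by rw [hb, ha]; ring,
      show nu + 1 = a + c + 1 by rw [ha, hc]; ring, ← tsum_mul_left, ← tsum_mul_right]
    refine tsum_congr fun n => ?_
    simp only [F, A]
    rw [show (d - 2) / 2 = d / 2 - 1 by ring, hK, mul_rpow two_pos.le hu0.le,
      show -(2 * (c + n) + 2 * (d / 2) - 1) = -(2 * a) + -2 * (n : ℝ) by rw [ha, hc]; ring,
      rpow_add hu0, rpow_neg hu0.le (2 * a)]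
    field_simp
  rw [hseries, (hasSum_integral_of_summable_integral_norm
    (fun n => Integrable.of_integral_ne_zero (hF_pos n).ne')
    (by simpa only [hnorm] using hsum.summable)).unique hsum]
  have hdup := Gamma_mul_Gamma_add_half a
  rw [← hb, rpow_sub two_pos, rpow_one, sqrt_eq_rpow] at hdup
  rw [show nu ^ 2 - ((d - 1) / 2) ^ 2 = 4 * a * c by rw [ha, hc]; ring, hK,
    Gamma_add_one ha0.ne', Gamma_add_one hc0.ne',
    show π ^ (d / 2) = π ^ ((d - 1) / 2) * π ^ (1 / 2 : ℝ) by rw [← rpow_add pi_pos]; ring_nf]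
  field_simp at hdup ⊢
  linear_combination -2 * hdup

/-- Zero-loop (single line) integral on Euclidean AdS. -/
theorem zero_loop (d nu : ℝ) (hd : 1 ≤ d) (hnu : (d - 1) / 2 < nu) :
    IntegrableOn (fun u : ℝ => adsG d nu u * (u ^ 2 - 1) ^ ((d - 2) / 2)) (Set.Ioi 1) ∧
    (2 * Real.pi ^ (d / 2) / Real.Gamma (d / 2)) *
        ∫ u in Set.Ioi (1 : ℝ), adsG d nu u * (u ^ 2 - 1) ^ ((d - 2) / 2) =
      1 / (nu ^ 2 - ((d - 1) / 2) ^ 2) := by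
  have hint := integral_adsG_mul_sq_sub_one_rpow hd hnu
  have hG := Gamma_pos_of_pos (show 0 < d / 2 by linarith)
  have hmass : 0 < nu ^ 2 - ((d - 1) / 2) ^ 2 := by nlinarith
  refine ⟨Integrable.of_integral_ne_zero ?_, ?_⟩
  · rw [hint]
    positivity
  · rw [hint]
    field_simp
end

section
/- Let λ > 0 and ν > 0 be real with λ ≠ ν. Then the two-dimensional one-loop bubble integral converges and 2π · ∫₁^∞ G(2,λ,u)·G(2,ν,u) du = ( ψ(λ+1/2) − ψ(ν+1/2) ) / (2π·(λ²−ν²)). -/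
open MeasureTheory Real Filter

/-- The digamma function `ψ(x) = Γ′(x)/Γ(x)`. -/
noncomputable def digamma (x : ℝ) : ℝ := deriv Real.Gamma x / Real.Gamma x

open Topology Set

/-! ### The digamma function -/

lemma hasDerivAt_log_Gamma {x : ℝ} (hx : 0 < x) :
    HasDerivAt (fun y => Real.log (Real.Gamma y)) (digamma x) x := by
  have hd : DifferentiableAt ℝ Real.Gamma x :=
    Real.differentiableAt_Gamma fun m => by
      have : (0 : ℝ) ≤ m := m.cast_nonneg
      linarith
  exact hd.hasDerivAt.log (Real.Gamma_pos_of_pos hx).ne'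

lemma digamma_mono {x y : ℝ} (hx : 0 < x) (hxy : x ≤ y) : digamma x ≤ digamma y := by
  have h := Real.convexOn_log_Gamma.monotoneOn_deriv
    (fun z hz => (hasDerivAt_log_Gamma hz).differentiableAt)
  have hy : 0 < y := hx.trans_le hxy
  have := h (mem_Ioi.2 hx) (mem_Ioi.2 hy) hxy
  rwa [show (Real.log ∘ Real.Gamma) = fun y => Real.log (Real.Gamma y) from rfl,
    (hasDerivAt_log_Gamma hx).deriv, (hasDerivAt_log_Gamma hy).deriv] at this

lemma digamma_add_one {x : ℝ} (hx : 0 < x) : digamma (x + 1) = digamma x + 1 / x := by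
  have h₁ : HasDerivAt (fun y => Real.log (Real.Gamma (y + 1))) (digamma (x + 1)) x :=
    (hasDerivAt_log_Gamma (by linarith : 0 < x + 1)).comp_add_const x 1
  have h₂ : HasDerivAt (fun y => Real.log (Real.Gamma y) + Real.log y) (digamma x + 1 / x) x := by
    rw [one_div]
    exact (hasDerivAt_log_Gamma hx).add (Real.hasDerivAt_log hx.ne')
  refine h₁.unique (h₂.congr_of_eventuallyEq ?_)
  filter_upwards [lt_mem_nhds hx] with y hy
  rw [Real.Gamma_add_one hy.ne', Real.log_mul hy.ne' (Real.Gamma_pos_of_pos hy).ne', add_comm]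

lemma digamma_add_nat_sub_le {x : ℝ} (hx : 0 < x) (m : ℕ) :
    digamma (x + m) - digamma x ≤ m / x := by
  induction m with
  | zero => simp
  | succ m ih =>
    have hm : (0 : ℝ) ≤ m := m.cast_nonneg
    have h := digamma_add_one (by linarith : 0 < x + m)
    have h' : 1 / (x + m) ≤ 1 / x := one_div_le_one_div_of_le hx (by linarith)
    push_cast
    rw [← add_assoc, h, add_div]
    linarith

/-! ### Coefficients of the Legendre function of the second kind -/

/-- Coefficients of `2 Q_{s-1}` in powers of the inverse argument. -/
noncomputable def legCoeff (s : ℝ) (n : ℕ) : ℝ :=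
  Real.Gamma (s / 2 + n) * Real.Gamma (s / 2 + 1 / 2 + n) /
    (Real.Gamma (s + 1 / 2 + n) * (n.factorial : ℝ))

lemma legCoeff_pos {s : ℝ} (hs : 0 < s) (n : ℕ) : 0 < legCoeff s n := by
  have hn : (0 : ℝ) ≤ n := n.cast_nonneg
  have h₁ := Real.Gamma_pos_of_pos (by linarith : 0 < s / 2 + n)
  have h₂ := Real.Gamma_pos_of_pos (by linarith : 0 < s / 2 + 1 / 2 + n)
  have h₃ := Real.Gamma_pos_of_pos (by linarith : 0 < s + 1 / 2 + n)
  unfold legCoeff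
  positivity

lemma legCoeff_succ {s : ℝ} (hs : 0 < s) (n : ℕ) :
    legCoeff s (n + 1) * ((s + 1 / 2 + n) * (n + 1)) =
      legCoeff s n * ((s / 2 + n) * (s / 2 + 1 / 2 + n)) := by
  have hn : (0 : ℝ) ≤ n := n.cast_nonneg
  have h₁ : 0 < s / 2 + n := by linarith
  have h₂ : 0 < s / 2 + 1 / 2 + n := by linarith
  have h₃ : 0 < s + 1 / 2 + n := by linarith
  have g₃ := Real.Gamma_pos_of_pos h₃
  unfold legCoeff
  push_cast [Nat.factorial_succ]
  rw [← add_assoc, ← add_assoc, ← add_assoc, Real.Gamma_add_one h₁.ne', Real.Gamma_add_one h₂.ne',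
    Real.Gamma_add_one h₃.ne']
  have : (n.factorial : ℝ) ≠ 0 := by positivity
  have : (n : ℝ) + 1 ≠ 0 := by positivity
  field_simp

lemma legCoeff_add_one {s : ℝ} (hs : 0 < s) (n : ℕ) :
    legCoeff (s + 1) n * (s + 1 / 2 + n) = legCoeff s n * (s / 2 + n) := by
  have hn : (0 : ℝ) ≤ n := n.cast_nonneg
  have h₁ : 0 < s / 2 + n := by linarith
  have h₃ : 0 < s + 1 / 2 + n := by linarith
  have g₃ := Real.Gamma_pos_of_pos h₃
  unfold legCoeff
  rw [show (s + 1) / 2 + (n : ℝ) = s / 2 + 1 / 2 + n by ring,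
    show (s + 1) / 2 + 1 / 2 + (n : ℝ) = s / 2 + n + 1 by ring,
    show s + 1 + 1 / 2 + (n : ℝ) = s + 1 / 2 + n + 1 by ring, Real.Gamma_add_one h₁.ne',
    Real.Gamma_add_one h₃.ne']
  have : (n.factorial : ℝ) ≠ 0 := by positivity
  field_simp

lemma legCoeff_antitone {s t : ℝ} (hs : 0 < s) (hst : s ≤ t) (n : ℕ) :
    legCoeff t n ≤ legCoeff s n := by
  have hn : (0 : ℝ) ≤ n := n.cast_nonneg
  have hf : 0 < (n.factorial : ℝ) := by positivity
  let h : ℝ → ℝ := fun x => Real.log (Real.Gamma (x / 2 + n)) +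
    Real.log (Real.Gamma (x / 2 + 1 / 2 + n)) - Real.log (Real.Gamma (x + 1 / 2 + n))
  have hd : ∀ x, 0 < x → HasDerivAt h (digamma (x / 2 + n) * (1 / 2) +
      digamma (x / 2 + 1 / 2 + n) * (1 / 2) - digamma (x + 1 / 2 + n) * 1) x := by
    intro x hx
    have d₁ : HasDerivAt (fun x : ℝ => x / 2 + (n : ℝ)) (1 / 2) x :=
      ((hasDerivAt_id x).div_const 2).add_const _
    have d₂ : HasDerivAt (fun x : ℝ => x / 2 + 1 / 2 + (n : ℝ)) (1 / 2) x :=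
      (((hasDerivAt_id x).div_const 2).add_const _).add_const _
    have d₃ : HasDerivAt (fun x : ℝ => x + 1 / 2 + (n : ℝ)) 1 x :=
      ((hasDerivAt_id x).add_const _).add_const _
    exact (((hasDerivAt_log_Gamma (by linarith : 0 < x / 2 + n)).comp x d₁).add
      ((hasDerivAt_log_Gamma (by linarith : 0 < x / 2 + 1 / 2 + n)).comp x d₂)).sub
      ((hasDerivAt_log_Gamma (by linarith : 0 < x + 1 / 2 + n)).comp x d₃)
  have hanti : AntitoneOn h (Ioi 0) := by
    refine antitoneOn_of_deriv_nonpos (convex_Ioi 0)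
      (fun x hx => (hd x hx).continuousAt.continuousWithinAt)
      (fun x hx => (hd x (interior_subset hx)).differentiableAt.differentiableWithinAt) ?_
    intro x hx
    have hx : 0 < x := interior_subset hx
    rw [(hd x hx).deriv]
    have e₁ := digamma_mono (by linarith : 0 < x / 2 + n)
      (by linarith : x / 2 + n ≤ x + 1 / 2 + n)
    have e₂ := digamma_mono (by linarith : 0 < x / 2 + 1 / 2 + n)
      (by linarith : x / 2 + 1 / 2 + n ≤ x + 1 / 2 + n)
    linarith
  have key : ∀ x, 0 < x → legCoeff x n = Real.exp (h x) / n.factorial := by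
    intro x hx
    have h₁ := Real.Gamma_pos_of_pos (by linarith : 0 < x / 2 + n)
    have h₂ := Real.Gamma_pos_of_pos (by linarith : 0 < x / 2 + 1 / 2 + n)
    have h₃ := Real.Gamma_pos_of_pos (by linarith : 0 < x + 1 / 2 + n)
    simp only [h, legCoeff]
    rw [Real.exp_sub, Real.exp_add, Real.exp_log h₁, Real.exp_log h₂, Real.exp_log h₃, div_div]
  have ht := hs.trans_le hst
  rw [key s hs, key t ht]
  have := Real.exp_le_exp.2 (hanti (mem_Ioi.2 hs) (mem_Ioi.2 ht) hst)
  gcongr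

lemma Gamma_add_nat_add_one_div {x : ℝ} (hx : 0 < x) {n : ℕ} (hn : 0 < n) :
    Real.Gamma (x + n + 1) = Real.Gamma x / Real.GammaSeq x n * ((n : ℝ) ^ x * n.factorial) := by
  have hprod : Real.Gamma (x + n + 1) = Real.Gamma x * ∏ j ∈ Finset.range (n + 1), (x + j) := by
    clear hn
    induction n with
    | zero => simp [Real.Gamma_add_one hx.ne', mul_comm]
    | succ n ih =>
      have h0 : x + (n + 1 : ℝ) ≠ 0 := by positivity
      rw [Finset.prod_range_succ, ← mul_assoc, ← ih]
      push_cast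
      rw [Real.Gamma_add_one h0, mul_comm, add_assoc]
  have hn' : (0 : ℝ) < n := by exact_mod_cast hn
  have hp : 0 < ∏ j ∈ Finset.range (n + 1), (x + j) := Finset.prod_pos fun j _ => by positivity
  have : 0 < (n : ℝ) ^ x := by positivity
  rw [hprod, Real.GammaSeq]
  field_simp

lemma tendsto_nat_mul_legCoeff {s : ℝ} (hs : 0 < s) :
    Tendsto (fun n : ℕ => (n : ℝ) * legCoeff s n) atTop (𝓝 1) := by
  rw [← tendsto_add_atTop_iff_nat 1]
  have g : ∀ x : ℝ, 0 < x →
      Tendsto (fun n => Real.Gamma x / Real.GammaSeq x n) atTop (𝓝 1) := by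
    intro x hx
    have hx' := (Real.Gamma_pos_of_pos hx).ne'
    have h := (tendsto_const_nhds (x := Real.Gamma x)).div (Real.GammaSeq_tendsto_Gamma x) hx'
    rw [div_self hx'] at h
    exact h
  have h₁ : 0 < s / 2 := by linarith
  have h₂ : 0 < s / 2 + 1 / 2 := by linarith
  have h₃ : 0 < s + 1 / 2 := by linarith
  have := ((g _ h₁).mul (g _ h₂)).div (g _ h₃) one_ne_zero
  rw [one_mul, div_one] at this
  refine this.congr' ?_
  filter_upwards [eventually_gt_atTop 0] with n hn
  have hn' : (0 : ℝ) < n := by exact_mod_cast hn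
  have e₁ := Gamma_add_nat_add_one_div h₁ hn
  have e₂ := Gamma_add_nat_add_one_div h₂ hn
  have e₃ := Gamma_add_nat_add_one_div h₃ hn
  have hpow : (n : ℝ) ^ (s + 1 / 2) = (n : ℝ) ^ (s / 2) * (n : ℝ) ^ (s / 2 + 1 / 2) := by
    rw [← Real.rpow_add hn']; ring_nf
  have : (n.factorial : ℝ) ≠ 0 := by positivity
  have p₁ : 0 < (n : ℝ) ^ (s / 2) := by positivity
  have p₂ : 0 < (n : ℝ) ^ (s / 2 + 1 / 2) := by positivity
  simp only [Pi.div_apply, legCoeff]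
  push_cast [Nat.factorial_succ]
  rw [← add_assoc, ← add_assoc, ← add_assoc, e₁, e₂, e₃, hpow]
  generalize Real.Gamma (s / 2) / Real.GammaSeq (s / 2) n = A
  generalize Real.Gamma (s / 2 + 1 / 2) / Real.GammaSeq (s / 2 + 1 / 2) n = B
  generalize Real.Gamma (s + 1 / 2) / Real.GammaSeq (s + 1 / 2) n = C
  rcases eq_or_ne C 0 with rfl | hC
  · simp
  have : (n : ℝ) + 1 ≠ 0 := by positivity
  field_simp

lemma tendsto_legCoeff {s : ℝ} (hs : 0 < s) : Tendsto (legCoeff s) atTop (𝓝 0) := by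
  have h := (tendsto_nat_mul_legCoeff hs).mul tendsto_inv_atTop_nhds_zero_nat
  rw [mul_zero] at h
  refine h.congr' ?_
  filter_upwards [eventually_gt_atTop 0] with n hn
  have hn' : (n : ℝ) ≠ 0 := by exact_mod_cast hn.ne'
  field_simp

/-- Coefficients of `-2 Q_{s-1}'`. -/
noncomputable def legDerivCoeff (s : ℝ) (n : ℕ) : ℝ := (s + 2 * n) * legCoeff s n

lemma tendsto_legDerivCoeff {s : ℝ} (hs : 0 < s) : Tendsto (legDerivCoeff s) atTop (𝓝 2) := by
  have h := ((tendsto_legCoeff hs).const_mul s).add ((tendsto_nat_mul_legCoeff hs).const_mul 2)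
  rw [mul_zero, zero_add, mul_one] at h
  refine h.congr fun n => ?_
  simp only [legDerivCoeff]
  ring

/-- Backward differences of a sequence, extended by zero to negative indices. -/
def backDiff (e : ℕ → ℝ) : ℕ → ℝ
  | 0 => e 0
  | n + 1 => e (n + 1) - e n

lemma sum_range_backDiff (e : ℕ → ℝ) (n : ℕ) :
    ∑ i ∈ Finset.range (n + 1), backDiff e i = e n := by
  induction n with
  | zero => simp [backDiff]
  | succ n ih => rw [Finset.sum_range_succ, ih]; simp [backDiff]

lemma exists_abs_le_of_tendsto {c : ℕ → ℝ} {l : ℝ} (h : Tendsto c atTop (𝓝 l)) :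
    ∃ C, ∀ n, |c n| ≤ C := by
  obtain ⟨C, hC⟩ := h.norm.bddAbove_range
  exact ⟨C, fun n => hC ⟨n, rfl⟩⟩

lemma exists_abs_backDiff_le {e : ℕ → ℝ} (h : ∃ C, ∀ n, |e n| ≤ C) :
    ∃ C, ∀ n, |backDiff e n| ≤ C := by
  obtain ⟨C, hC⟩ := h
  refine ⟨C + C, fun n => ?_⟩
  cases n with
  | zero => exact (hC 0).trans (by linarith [(abs_nonneg _).trans (hC 0)])
  | succ n => exact (abs_sub _ _).trans (add_le_add (hC _) (hC _))

lemma mul_backDiff_legDerivCoeff {s : ℝ} (hs : 0 < s) (n : ℕ) :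
    (s - 1 + 2 * n) * backDiff (legDerivCoeff s) n = s * (s - 1) * legCoeff s n := by
  cases n with
  | zero => simp [backDiff, legDerivCoeff]; ring
  | succ n =>
    have h := legCoeff_succ hs n
    simp only [backDiff, legDerivCoeff]
    push_cast
    linear_combination 4 * h

lemma legCoeff_add_one_eq_backDiff {s : ℝ} (hs : 0 < s) (n : ℕ) :
    s * legCoeff (s + 1) n = s * legCoeff s (n + 1) - backDiff (legDerivCoeff s) (n + 1) := by
  have h := legCoeff_succ hs n
  have h' := legCoeff_add_one hs n
  have hn : (0 : ℝ) ≤ n := n.cast_nonneg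
  have h₃ : s + 1 / 2 + n ≠ 0 := by positivity
  simp only [backDiff, legDerivCoeff]
  push_cast
  apply mul_right_cancel₀ h₃
  linear_combination s * h' + 2 * h

/-! ### Series in inverse powers -/

/-- The series `∑ cₙ u^{-(s+2n)}`. -/
noncomputable def invPowSeries (c : ℕ → ℝ) (s u : ℝ) : ℝ := ∑' n : ℕ, c n * u ^ (-(s + 2 * n))

lemma rpow_neg_add_two_mul {u : ℝ} (hu : 0 < u) (s : ℝ) (n : ℕ) :
    u ^ (-(s + 2 * n)) = u ^ (-s) * (u ^ (-2 : ℝ)) ^ n := by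
  rw [← Real.rpow_natCast, ← Real.rpow_mul hu.le, ← Real.rpow_add hu]
  ring_nf

lemma rpow_neg_two_lt_one {u : ℝ} (hu : 1 < u) : u ^ (-2 : ℝ) < 1 :=
  Real.rpow_lt_one_of_one_lt_of_neg hu (by norm_num)

lemma summable_linear_mul_geometric {r : ℝ} (h₀ : 0 ≤ r) (h₁ : r < 1) (A B : ℝ) :
    Summable fun n : ℕ => (A + B * n) * r ^ n := by
  have h := (summable_geometric_of_lt_one h₀ h₁).mul_left A
  have h' := (summable_pow_mul_geometric_of_norm_lt_one (R := ℝ) 1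
    (by rwa [Real.norm_of_nonneg h₀] : ‖r‖ < 1)).mul_left B
  refine (h.add h').congr fun n => ?_
  ring

lemma summable_invPowSeries {c : ℕ → ℝ} (hc : ∃ C, ∀ n, |c n| ≤ C) (s : ℝ) {u : ℝ} (hu : 1 < u) :
    Summable fun n : ℕ => c n * u ^ (-(s + 2 * n)) := by
  obtain ⟨C, hC⟩ := hc
  have hu0 : 0 < u := by linarith
  refine Summable.of_norm_bounded (g := fun n : ℕ => C * u ^ (-s) * (u ^ (-2 : ℝ)) ^ n)
    ((summable_geometric_of_lt_one (by positivity) (rpow_neg_two_lt_one hu)).mul_left _) fun n => ?_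
  rw [rpow_neg_add_two_mul hu0, norm_mul, Real.norm_eq_abs, Real.norm_of_nonneg (by positivity),
    ← mul_assoc]
  have := hC n
  gcongr

lemma invPowSeries_eq {u : ℝ} (hu : 0 < u) (c : ℕ → ℝ) (s : ℝ) :
    invPowSeries c s u = u ^ (-s) * ∑' n : ℕ, c n * (u ^ (-2 : ℝ)) ^ n := by
  rw [invPowSeries, ← tsum_mul_left]
  congr 1 with n
  rw [rpow_neg_add_two_mul hu]
  ring

lemma exists_abs_invPowSeries_le {c : ℕ → ℝ} (hc : ∃ C, ∀ n, |c n| ≤ C) (s : ℝ) :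
    ∃ K, ∀ u, 2 ≤ u → |invPowSeries c s u| ≤ K * u ^ (-s) := by
  obtain ⟨C, hC⟩ := hc
  have hC0 : 0 ≤ C := (abs_nonneg _).trans (hC 0)
  have h2 : ((2 : ℝ) ^ (-2 : ℝ)) < 1 := rpow_neg_two_lt_one (by norm_num)
  have hsum := (summable_geometric_of_lt_one (by positivity) h2).mul_left C
  refine ⟨∑' n : ℕ, C * ((2 : ℝ) ^ (-2 : ℝ)) ^ n, fun u hu => ?_⟩
  have hu0 : 0 < u := by linarith
  have hle : u ^ (-2 : ℝ) ≤ (2 : ℝ) ^ (-2 : ℝ) :=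
    Real.rpow_le_rpow_of_nonpos (by norm_num) hu (by norm_num)
  rw [invPowSeries_eq hu0, abs_mul, abs_of_pos (by positivity), mul_comm]
  gcongr
  rw [← Real.norm_eq_abs]
  refine tsum_of_norm_bounded hsum.hasSum fun n => ?_
  rw [norm_mul, Real.norm_eq_abs, Real.norm_of_nonneg (by positivity)]
  have := hC n
  gcongr

lemma hasDerivAt_invPowSeries {c : ℕ → ℝ} (hc : ∃ C, ∀ n, |c n| ≤ C) {s : ℝ} (hs : -1 ≤ s)
    {u : ℝ} (hu : 1 < u) :
    HasDerivAt (invPowSeries c s) (-invPowSeries (fun n => (s + 2 * n) * c n) (s + 1) u) u := by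
  have hsum := summable_invPowSeries hc s hu
  obtain ⟨C, hC⟩ := hc
  obtain ⟨r, hr, hru⟩ := exists_between hu
  have hr0 : 0 < r := by linarith
  have hC0 : 0 ≤ C := (abs_nonneg _).trans (hC 0)
  have key := hasDerivAt_tsum_of_isPreconnected (𝕜 := ℝ) (t := Ioi r) (y₀ := u) (y := u)
    (u := fun n : ℕ => (|s| * C * r ^ (-(s + 1)) + 2 * C * r ^ (-(s + 1)) * n) *
      (r ^ (-2 : ℝ)) ^ n)
    (g := fun (n : ℕ) (y : ℝ) => c n * y ^ (-(s + 2 * n)))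
    (g' := fun (n : ℕ) (y : ℝ) => c n * (-(s + 2 * n) * y ^ (-(s + 2 * n) - 1)))
    (summable_linear_mul_geometric (by positivity) (rpow_neg_two_lt_one hr) _ _)
    isOpen_Ioi isPreconnected_Ioi ?_ ?_ hru hsum hru
  · have heq : -invPowSeries (fun n => (s + 2 * n) * c n) (s + 1) u =
        ∑' n : ℕ, c n * (-(s + 2 * n) * u ^ (-(s + 2 * n) - 1)) := by
      rw [invPowSeries, ← tsum_neg]
      congr 1 with n
      rw [show -(s + 2 * (n : ℝ)) - 1 = -(s + 1 + 2 * n) by ring]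
      ring
    rw [heq]
    exact key
  · intro n y hy
    have hy0 : 0 < y := hr0.trans hy
    exact (Real.hasDerivAt_rpow_const (Or.inl hy0.ne')).const_mul _
  · intro n y hy
    have hy0 : 0 < y := hr0.trans hy
    have hn : (0 : ℝ) ≤ n := n.cast_nonneg
    have h₁ : y ^ (-(s + 2 * n) - 1) ≤ r ^ (-(s + 1)) * (r ^ (-2 : ℝ)) ^ n := by
      rw [← rpow_neg_add_two_mul hr0, show -(s + 2 * (n : ℝ)) - 1 = -(s + 1 + 2 * n) by ring]
      exact Real.rpow_le_rpow_of_nonpos hr0 (le_of_lt hy) (by linarith)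
    have h₂ : |-(s + 2 * (n : ℝ))| ≤ |s| + 2 * n := by
      rw [abs_neg]
      exact (abs_add_le _ _).trans (by rw [abs_of_nonneg (by positivity : 0 ≤ 2 * (n : ℝ))])
    rw [norm_mul, norm_mul, Real.norm_eq_abs, Real.norm_eq_abs, Real.norm_of_nonneg (by positivity)]
    calc |c n| * (|-(s + 2 * (n : ℝ))| * y ^ (-(s + 2 * n) - 1))
        ≤ C * ((|s| + 2 * n) * (r ^ (-(s + 1)) * (r ^ (-2 : ℝ)) ^ n)) := by
          have := hC n
          gcongr
      _ = _ := by ring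

lemma sq_sub_one_mul_invPowSeries {e : ℕ → ℝ} (he : ∃ C, ∀ n, |e n| ≤ C) (s : ℝ) {u : ℝ}
    (hu : 1 < u) :
    (u ^ 2 - 1) * invPowSeries e (s + 2) u = invPowSeries (backDiff e) s u := by
  have hu0 : 0 < u := by linarith
  have h₁ := summable_invPowSeries he s hu
  have h₂ := summable_invPowSeries he (s + 2) hu
  have h₃ := summable_invPowSeries (exists_abs_backDiff_le he) s hu
  have hsq : u ^ 2 * invPowSeries e (s + 2) u = invPowSeries e s u := by
    rw [invPowSeries, invPowSeries, ← tsum_mul_left]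
    congr 1 with n
    rw [show -(s + 2 * (n : ℝ)) = (2 : ℕ) + -(s + 2 + 2 * n) by push_cast; ring,
      Real.rpow_add hu0, Real.rpow_natCast]
    ring
  rw [sub_mul, hsq, one_mul]
  have shift : ∀ n : ℕ, u ^ (-(s + 2 * ((n + 1 : ℕ) : ℝ))) = u ^ (-(s + 2 + 2 * (n : ℝ))) := by
    intro n
    congr 1
    push_cast
    ring
  have h₁' := (summable_nat_add_iff 1).2 h₁
  rw [invPowSeries, invPowSeries, invPowSeries, h₁.tsum_eq_zero_add, h₃.tsum_eq_zero_add]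
  simp only [shift, backDiff, sub_mul] at h₁' ⊢
  rw [h₁'.tsum_sub h₂]
  ring

lemma tendsto_invPowSeries_backDiff {e : ℕ → ℝ} {l : ℝ} (he : Tendsto e atTop (𝓝 l)) (s : ℝ) :
    Tendsto (invPowSeries (backDiff e) s) (𝓝[>] 1) (𝓝 l) := by
  have hsum : Tendsto (fun n => ∑ i ∈ Finset.range n, backDiff e i) atTop (𝓝 l) := by
    rw [← tendsto_add_atTop_iff_nat 1]
    simpa only [sum_range_backDiff] using he
  have habel := Real.tendsto_tsum_powerSeries_nhdsWithin_lt hsum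
  have hcont : ∀ t : ℝ, Tendsto (fun u : ℝ => u ^ t) (𝓝[>] 1) (𝓝 1) := by
    intro t
    have := (Real.continuousAt_rpow_const 1 t (Or.inl one_ne_zero)).tendsto
    rw [Real.one_rpow] at this
    exact this.mono_left nhdsWithin_le_nhds
  have hx : Tendsto (fun u : ℝ => u ^ (-2 : ℝ)) (𝓝[>] 1) (𝓝[<] 1) := by
    refine tendsto_nhdsWithin_iff.2 ⟨hcont _, ?_⟩
    filter_upwards [self_mem_nhdsWithin] with u hu using rpow_neg_two_lt_one hu
  have := (hcont (-s)).mul (habel.comp hx)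
  rw [one_mul] at this
  refine this.congr' ?_
  filter_upwards [self_mem_nhdsWithin] with u hu
  rw [invPowSeries_eq (zero_lt_one.trans hu)]
  rfl

/-! ### The Legendre function of the second kind -/

/-- The function `2 Q_{s-1}`. -/
noncomputable def legQ (s u : ℝ) : ℝ := invPowSeries (legCoeff s) s u

/-- The function `2 (u² - 1) Q_{s-1}'`. -/
noncomputable def legP (s u : ℝ) : ℝ := -invPowSeries (backDiff (legDerivCoeff s)) (s - 1) u

section Legendre

variable {s : ℝ}

lemma exists_abs_legCoeff_le (hs : 0 < s) : ∃ C, ∀ n, |legCoeff s n| ≤ C :=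
  exists_abs_le_of_tendsto (tendsto_legCoeff hs)

lemma exists_abs_legDerivCoeff_le (hs : 0 < s) : ∃ C, ∀ n, |legDerivCoeff s n| ≤ C :=
  exists_abs_le_of_tendsto (tendsto_legDerivCoeff hs)

lemma legQ_nonneg (hs : 0 < s) {u : ℝ} (hu : 1 < u) : 0 ≤ legQ s u :=
  tsum_nonneg fun n => mul_nonneg (legCoeff_pos hs n).le (by positivity)

lemma legQ_antitone {t : ℝ} (hs : 0 < s) (hst : s ≤ t) {u : ℝ} (hu : 1 < u) :
    legQ t u ≤ legQ s u := by
  have ht := hs.trans_le hst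
  refine (summable_invPowSeries (exists_abs_legCoeff_le ht) t hu).tsum_le_tsum (fun n => ?_)
    (summable_invPowSeries (exists_abs_legCoeff_le hs) s hu)
  have := (legCoeff_pos hs n).le
  exact mul_le_mul (legCoeff_antitone hs hst n)
    (Real.rpow_le_rpow_of_exponent_le hu.le (by linarith)) (by positivity) this

lemma hasDerivAt_legQ (hs : 0 < s) {u : ℝ} (hu : 1 < u) :
    HasDerivAt (legQ s) (legP s u / (u ^ 2 - 1)) u := by
  have h := hasDerivAt_invPowSeries (exists_abs_legCoeff_le hs) (by linarith : -1 ≤ s) hu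
  have h' := sq_sub_one_mul_invPowSeries (exists_abs_legDerivCoeff_le hs) (s - 1) hu
  have hne : u ^ 2 - 1 ≠ 0 := by nlinarith
  have heq : legP s u / (u ^ 2 - 1) =
      -invPowSeries (fun n => (s + 2 * n) * legCoeff s n) (s + 1) u := by
    rw [legP, ← h', show s - 1 + 2 = s + 1 by ring, neg_div, mul_div_cancel_left₀ _ hne]
    rfl
  rw [heq]
  exact h

lemma hasDerivAt_legP (hs : 0 < s) {u : ℝ} (hu : 1 < u) :
    HasDerivAt (legP s) (s * (s - 1) * legQ s u) u := by
  have h := (hasDerivAt_invPowSeries (exists_abs_backDiff_le (exists_abs_legDerivCoeff_le hs))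
    (by linarith : -1 ≤ s - 1) hu).neg
  have heq : s * (s - 1) * legQ s u =
      invPowSeries (fun n => (s - 1 + 2 * n) * backDiff (legDerivCoeff s) n) (s - 1 + 1) u := by
    rw [legQ, invPowSeries, invPowSeries, ← tsum_mul_left]
    congr 1 with n
    rw [mul_backDiff_legDerivCoeff hs, sub_add_cancel]
    ring
  rw [heq, ← neg_neg (invPowSeries _ _ _)]
  exact h

lemma tendsto_legP (hs : 0 < s) : Tendsto (legP s) (𝓝[>] 1) (𝓝 (-2)) :=
  (tendsto_invPowSeries_backDiff (tendsto_legDerivCoeff hs) (s - 1)).neg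

lemma mul_legQ_add_one (hs : 0 < s) {u : ℝ} (hu : 1 < u) :
    s * (legQ (s + 1) u - u * legQ s u) = legP s u := by
  have hu0 : 0 < u := by linarith
  have h₁ := summable_invPowSeries (exists_abs_legCoeff_le hs) (s - 1) hu
  have h₃ := summable_invPowSeries (exists_abs_backDiff_le (exists_abs_legDerivCoeff_le hs))
    (s - 1) hu
  have hmul : u * legQ s u = invPowSeries (legCoeff s) (s - 1) u := by
    rw [legQ, invPowSeries, invPowSeries, ← tsum_mul_left]
    congr 1 with n
    rw [show -(s - 1 + 2 * (n : ℝ)) = -(s + 2 * n) + 1 by ring, Real.rpow_add_one hu0.ne']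
    ring
  have shift : ∀ n : ℕ, u ^ (-(s - 1 + 2 * ((n + 1 : ℕ) : ℝ))) = u ^ (-(s + 1 + 2 * (n : ℝ))) := by
    intro n
    congr 1
    push_cast
    ring
  have h₁' := (summable_nat_add_iff 1).2 h₁
  have h₃' := (summable_nat_add_iff 1).2 h₃
  have hsum : s * legQ (s + 1) u = s * ∑' n : ℕ, legCoeff s (n + 1) * u ^ (-(s + 1 + 2 * (n : ℝ))) -
      ∑' n : ℕ, backDiff (legDerivCoeff s) (n + 1) * u ^ (-(s + 1 + 2 * (n : ℝ))) := by
    simp only [shift] at h₁' h₃'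
    rw [← tsum_mul_left, ← (h₁'.mul_left s).tsum_sub h₃', legQ, invPowSeries, ← tsum_mul_left]
    congr 1 with n
    rw [← mul_assoc, legCoeff_add_one_eq_backDiff hs]
    ring
  rw [mul_sub, hmul, hsum, legP, invPowSeries, invPowSeries, h₁.tsum_eq_zero_add,
    h₃.tsum_eq_zero_add]
  simp only [shift]
  simp only [backDiff, legDerivCoeff, Nat.cast_zero]
  ring

/-! ### Behaviour at the endpoints -/

lemma exists_legQ_le (hs : 0 < s) :
    ∃ K, 0 ≤ K ∧ ∀ᶠ u in 𝓝[>] (1 : ℝ), legQ s u ≤ K * (u - 1) ^ (-(1 / 4) : ℝ) := by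
  obtain ⟨b, hb, hsub⟩ := mem_nhdsGT_iff_exists_Ioo_subset.1
    ((tendsto_legP hs).eventually (lt_mem_nhds (by norm_num : (-3 : ℝ) < -2)))
  have hb : 1 < b := hb
  obtain ⟨m, hm, hmb⟩ := exists_between (lt_min hb one_lt_two)
  have hmb' := hmb.trans_le (min_le_left _ _)
  have hm2 := hmb.trans_le (min_le_right _ _)
  let h : ℝ → ℝ := fun u => legQ s u - 12 * (u - 1) ^ (-(1 / 4) : ℝ)
  have hd : ∀ u, 1 < u → HasDerivAt h (legP s u / (u ^ 2 - 1) -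
      12 * (1 * (-(1 / 4)) * (u - 1) ^ (-(1 / 4) - 1 : ℝ))) u := fun u hu =>
    (hasDerivAt_legQ hs hu).sub
      ((((hasDerivAt_id u).sub_const 1).rpow_const (Or.inl (sub_pos.2 hu).ne')).const_mul 12)
  have hmono : MonotoneOn h (Ioc 1 m) := by
    refine monotoneOn_of_deriv_nonneg (convex_Ioc 1 m)
      (fun u hu => (hd u hu.1).continuousAt.continuousWithinAt)
      (fun u hu => (hd u (interior_subset hu).1).differentiableAt.differentiableWithinAt) ?_
    intro u hu
    have hu := interior_subset hu
    have hu1 : 0 < u - 1 := sub_pos.2 hu.1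
    have hp : -3 < legP s u := hsub ⟨hu.1, hu.2.trans_lt hmb'⟩
    rw [(hd u hu.1).deriv]
    have h₁ : (u - 1)⁻¹ ≤ (u - 1) ^ (-(1 / 4) - 1 : ℝ) := by
      rw [← Real.rpow_neg_one]
      exact Real.rpow_le_rpow_of_exponent_ge hu1 (by linarith [hu.2]) (by norm_num)
    have h₂ : -3 * (u - 1)⁻¹ ≤ legP s u / (u ^ 2 - 1) := by
      rw [← div_eq_mul_inv, div_le_div_iff₀ hu1 (by nlinarith)]
      nlinarith
    linarith
  refine ⟨legQ s m + 12, by linarith [legQ_nonneg hs hm], ?_⟩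
  filter_upwards [Ioo_mem_nhdsGT hm] with u hu
  have hu1 : 0 < u - 1 := sub_pos.2 hu.1
  have hle : h u ≤ h m := hmono ⟨hu.1, hu.2.le⟩ ⟨hm, le_rfl⟩ hu.2.le
  have hone : 1 ≤ (u - 1) ^ (-(1 / 4) : ℝ) :=
    Real.one_le_rpow_of_pos_of_le_one_of_nonpos hu1 (by linarith [hu.2]) (by norm_num)
  have hpos : 0 ≤ (m - 1) ^ (-(1 / 4) : ℝ) := Real.rpow_nonneg (by linarith) _
  have hq := legQ_nonneg hs hm
  simp only [h] at hle
  nlinarith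

lemma exists_abs_legP_add_two_le (hs : 0 < s) :
    ∃ M, ∀ᶠ u in 𝓝[>] (1 : ℝ), |legP s u + 2| ≤ M * (u - 1) ^ (3 / 4 : ℝ) := by
  obtain ⟨K, hK, hev⟩ := exists_legQ_le hs
  obtain ⟨b, hb, hsub⟩ := mem_nhdsGT_iff_exists_Ioo_subset.1 hev
  have hb : 1 < b := hb
  let M : ℝ := 4 / 3 * (|s * (s - 1)| * K)
  have key : ∀ σ : ℝ, |σ| = 1 → ∀ u ∈ Ioo 1 b,
      σ * (-2) ≤ σ * legP s u + M * (u - 1) ^ (3 / 4 : ℝ) := by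
    intro σ hσ
    let h : ℝ → ℝ := fun u => σ * legP s u + M * (u - 1) ^ (3 / 4 : ℝ)
    have hd : ∀ u, 1 < u → HasDerivAt h (σ * (s * (s - 1) * legQ s u) +
        M * (1 * (3 / 4) * (u - 1) ^ (3 / 4 - 1 : ℝ))) u := fun u hu =>
      ((hasDerivAt_legP hs hu).const_mul σ).add
        ((((hasDerivAt_id u).sub_const 1).rpow_const (Or.inl (sub_pos.2 hu).ne')).const_mul M)
    have hmono : MonotoneOn h (Ioo 1 b) := by
      refine monotoneOn_of_deriv_nonneg (convex_Ioo 1 b)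
        (fun u hu => (hd u hu.1).continuousAt.continuousWithinAt)
        (fun u hu => (hd u (interior_subset hu).1).differentiableAt.differentiableWithinAt) ?_
      intro u hu
      have hu := interior_subset hu
      have hq : legQ s u ≤ K * (u - 1) ^ (-(1 / 4) : ℝ) := hsub hu
      have hq0 := legQ_nonneg hs hu.1
      rw [(hd u hu.1).deriv, show (3 / 4 - 1 : ℝ) = -(1 / 4) by norm_num]
      have h₁ : |σ * (s * (s - 1) * legQ s u)| ≤
          |s * (s - 1)| * (K * (u - 1) ^ (-(1 / 4) : ℝ)) := by
        rw [abs_mul, hσ, one_mul, abs_mul, abs_of_nonneg hq0]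
        gcongr
      have h₂ := neg_abs_le (σ * (s * (s - 1) * legQ s u))
      simp only [M]
      linarith
    have hlim : Tendsto h (𝓝[>] 1) (𝓝 (σ * (-2))) := by
      have h₁ : Tendsto (fun u : ℝ => (u - 1) ^ (3 / 4 : ℝ)) (𝓝[>] 1) (𝓝 0) := by
        have hc : Continuous fun u : ℝ => (u - 1) ^ (3 / 4 : ℝ) :=
          (continuous_id.sub continuous_const).rpow_const fun _ => Or.inr (by norm_num)
        have := hc.tendsto 1
        rw [sub_self, Real.zero_rpow (by norm_num)] at this
        exact this.mono_left nhdsWithin_le_nhds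
      simpa using ((tendsto_legP hs).const_mul σ).add (h₁.const_mul M)
    intro u hu
    refine le_of_tendsto hlim ?_
    filter_upwards [Ioo_mem_nhdsGT hu.1] with v hv
    exact hmono ⟨hv.1, hv.2.trans hu.2⟩ hu hv.2.le
  refine ⟨M, ?_⟩
  filter_upwards [Ioo_mem_nhdsGT hb] with u hu
  have h₁ := key 1 (by simp) u hu
  have h₂ := key (-1) (by simp) u hu
  rw [abs_le]
  constructor <;> linarith

lemma tendsto_mul_legQ (hs : 0 < s) {g : ℝ → ℝ}
    (hg : ∃ M, ∀ᶠ u in 𝓝[>] (1 : ℝ), |g u| ≤ M * (u - 1) ^ (3 / 4 : ℝ)) :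
    Tendsto (fun u => g u * legQ s u) (𝓝[>] 1) (𝓝 0) := by
  obtain ⟨M, hM⟩ := hg
  obtain ⟨K, hK, hq⟩ := exists_legQ_le hs
  have hlim : Tendsto (fun u : ℝ => M * K * (u - 1) ^ (1 / 2 : ℝ)) (𝓝[>] 1) (𝓝 0) := by
    have hc : Continuous fun u : ℝ => M * K * (u - 1) ^ (1 / 2 : ℝ) :=
      continuous_const.mul
        ((continuous_id.sub continuous_const).rpow_const fun _ => Or.inr (by norm_num))
    have := hc.tendsto 1
    rw [sub_self, Real.zero_rpow (by norm_num), mul_zero] at this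
    exact this.mono_left nhdsWithin_le_nhds
  refine squeeze_zero_norm' ?_ hlim
  filter_upwards [hM, hq, self_mem_nhdsWithin] with u h₁ h₂ (hu : 1 < u)
  have hu1 : 0 < u - 1 := sub_pos.2 hu
  rw [Real.norm_eq_abs, abs_mul, abs_of_nonneg (legQ_nonneg hs hu)]
  calc |g u| * legQ s u
      ≤ (M * (u - 1) ^ (3 / 4 : ℝ)) * (K * (u - 1) ^ (-(1 / 4) : ℝ)) :=
        mul_le_mul h₁ h₂ (legQ_nonneg hs hu) ((abs_nonneg _).trans h₁)
    _ = M * K * ((u - 1) ^ (3 / 4 : ℝ) * (u - 1) ^ (-(1 / 4) : ℝ)) := by ring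
    _ = M * K * (u - 1) ^ (1 / 2 : ℝ) := by rw [← Real.rpow_add hu1]; norm_num

lemma tendsto_legQ_add_one_sub (hs : 0 < s) :
    Tendsto (fun u => legQ (s + 1) u - legQ s u) (𝓝[>] 1) (𝓝 (-2 / s)) := by
  have h₁ : Tendsto (fun u => (u - 1) * legQ s u) (𝓝[>] 1) (𝓝 0) := by
    refine tendsto_mul_legQ hs ⟨1, ?_⟩
    filter_upwards [Ioo_mem_nhdsGT one_lt_two] with u hu
    have hu1 : 0 < u - 1 := sub_pos.2 hu.1
    rw [abs_of_pos hu1, one_mul]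
    exact Real.self_le_rpow_of_le_one hu1.le (by linarith [hu.2]) (by norm_num)
  have h := h₁.add ((tendsto_legP hs).div_const s)
  rw [zero_add] at h
  refine h.congr' ?_
  filter_upwards [self_mem_nhdsWithin] with u (hu : 1 < u)
  rw [← mul_legQ_add_one hs hu, mul_div_cancel_left₀ _ hs.ne']
  ring

/-- The Legendre function regularized so that its behaviour at `1` does not depend on `s`. -/
noncomputable def legReg (s u : ℝ) : ℝ := legQ s u + 2 * digamma s

lemma tendsto_legReg_add_nat_sub (hs : 0 < s) (m : ℕ) :
    Tendsto (fun u => legReg (s + m) u - legReg s u) (𝓝[>] 1) (𝓝 0) := by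
  induction m with
  | zero => simp
  | succ m ih =>
    have hm : 0 < s + m := by positivity
    have h := (tendsto_legQ_add_one_sub hm).add_const (2 * (1 / (s + m)))
    have h' := ih.add h
    rw [show 0 + (-2 / (s + m) + 2 * (1 / (s + m))) = 0 by ring] at h'
    refine h'.congr fun u => ?_
    simp only [legReg]
    push_cast
    rw [← add_assoc s, digamma_add_one hm]
    ring

lemma tendsto_legReg_sub_of_le {t : ℝ} (ht : 0 < t) (hts : t ≤ s) :
    Tendsto (fun u => legReg s u - legReg t u) (𝓝[>] 1) (𝓝 0) := by
  have hs := ht.trans_le hts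
  obtain ⟨m, hm⟩ := exists_nat_ge (s - t)
  rw [Metric.tendsto_nhds]
  intro ε hε
  obtain ⟨N, hN⟩ := exists_nat_gt (8 * m / ε)
  have hN0 : (0 : ℝ) ≤ N := N.cast_nonneg
  have htN : 0 < t + N := by positivity
  have hsmall : m / (t + N) ≤ ε / 8 := by
    rw [div_lt_iff₀ hε] at hN
    rw [div_le_iff₀ htN]
    nlinarith
  have h₁ := (Metric.tendsto_nhds.1 (tendsto_legReg_add_nat_sub hs N)) (ε / 4) (by positivity)
  have h₂ := (Metric.tendsto_nhds.1 (tendsto_legReg_add_nat_sub ht N)) (ε / 4) (by positivity)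
  have h₃ := (Metric.tendsto_nhds.1 (tendsto_legReg_add_nat_sub htN m)) (ε / 4) (by positivity)
  filter_upwards [h₁, h₂, h₃, self_mem_nhdsWithin] with u h₁ h₂ h₃ (hu : 1 < u)
  rw [Real.dist_eq, sub_zero, abs_lt] at h₁ h₂ h₃ ⊢
  have hψ := digamma_add_nat_sub_le htN m
  have hψ₁ := digamma_mono htN (by linarith : t + N ≤ s + N)
  have hψ₂ := digamma_mono (by linarith : 0 < s + N) (by linarith : s + N ≤ t + N + m)
  have hq₁ := legQ_antitone htN (by linarith : t + N ≤ s + N) hu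
  have hq₂ := legQ_antitone (by linarith : 0 < s + N) (by linarith : s + N ≤ t + N + m) hu
  simp only [legReg] at h₁ h₂ h₃ ⊢
  constructor <;> linarith [h₁.1, h₁.2, h₂.1, h₂.2, h₃.1, h₃.2]

lemma tendsto_legQ_sub {t : ℝ} (hs : 0 < s) (ht : 0 < t) :
    Tendsto (fun u => legQ s u - legQ t u) (𝓝[>] 1) (𝓝 (2 * (digamma t - digamma s))) := by
  have h : Tendsto (fun u => legReg s u - legReg t u) (𝓝[>] 1) (𝓝 0) := by
    rcases le_total t s with h | h
    · exact tendsto_legReg_sub_of_le ht h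
    · simpa using (tendsto_legReg_sub_of_le hs h).neg
  have h' := h.add_const (2 * (digamma t - digamma s))
  rw [zero_add] at h'
  refine h'.congr fun u => ?_
  simp only [legReg]
  ring

/-- The Wronskian of two Legendre functions, weighted by `u² - 1`. -/
noncomputable def legWronskian (s t u : ℝ) : ℝ := legP s u * legQ t u - legQ s u * legP t u

lemma hasDerivAt_legWronskian {t : ℝ} (hs : 0 < s) (ht : 0 < t) {u : ℝ} (hu : 1 < u) :
    HasDerivAt (legWronskian s t)
      ((s * (s - 1) - t * (t - 1)) * (legQ s u * legQ t u)) u := by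
  have h := ((hasDerivAt_legP hs hu).mul (hasDerivAt_legQ ht hu)).sub
    ((hasDerivAt_legQ hs hu).mul (hasDerivAt_legP ht hu))
  refine HasDerivAt.congr_deriv h ?_
  ring

lemma tendsto_legWronskian_one {t : ℝ} (hs : 0 < s) (ht : 0 < t) :
    Tendsto (legWronskian s t) (𝓝[>] 1) (𝓝 (4 * (digamma t - digamma s))) := by
  have h₁ := tendsto_mul_legQ ht (exists_abs_legP_add_two_le hs)
  have h₂ := tendsto_mul_legQ hs (exists_abs_legP_add_two_le ht)
  have h := (h₁.sub h₂).add ((tendsto_legQ_sub hs ht).const_mul 2)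
  rw [show 0 - 0 + 2 * (2 * (digamma t - digamma s)) = 4 * (digamma t - digamma s) by ring] at h
  refine h.congr fun u => ?_
  simp only [legWronskian]
  ring

lemma tendsto_legP_mul_legQ_atTop {t : ℝ} (hs : 0 < s) (ht : 0 < t) (hst : 1 < s + t) :
    Tendsto (fun u => legP s u * legQ t u) atTop (𝓝 0) := by
  obtain ⟨K, hK⟩ := exists_abs_invPowSeries_le
    (exists_abs_backDiff_le (exists_abs_legDerivCoeff_le hs)) (s - 1)
  obtain ⟨L, hL⟩ := exists_abs_invPowSeries_le (exists_abs_legCoeff_le ht) t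
  have hlim := (tendsto_rpow_neg_atTop (by linarith : 0 < s + t - 1)).const_mul (K * L)
  rw [mul_zero] at hlim
  refine squeeze_zero_norm' ?_ hlim
  filter_upwards [eventually_ge_atTop 2] with u hu
  have hu0 : 0 < u := by linarith
  rw [Real.norm_eq_abs, abs_mul, legP, abs_neg]
  calc _ ≤ (K * u ^ (-(s - 1))) * (L * u ^ (-t)) :=
        mul_le_mul (hK u hu) (hL u hu) (abs_nonneg _) ((abs_nonneg _).trans (hK u hu))
    _ = K * L * (u ^ (-(s - 1)) * u ^ (-t)) := by ring
    _ = K * L * u ^ (-(s + t - 1)) := by rw [← Real.rpow_add hu0]; ring_nf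

lemma tendsto_legWronskian_atTop {t : ℝ} (hs : 0 < s) (ht : 0 < t) (hst : 1 < s + t) :
    Tendsto (legWronskian s t) atTop (𝓝 0) := by
  have h := (tendsto_legP_mul_legQ_atTop hs ht hst).sub
    (tendsto_legP_mul_legQ_atTop ht hs (by linarith))
  rw [sub_zero] at h
  refine h.congr fun u => ?_
  simp only [legWronskian]
  ring

lemma integrableOn_and_integral_legQ_mul_legQ {t : ℝ} (hs : 0 < s) (ht : 0 < t) (hst : 1 < s + t)
    (hne : s ≠ t) :
    IntegrableOn (fun u => legQ s u * legQ t u) (Ioi 1) ∧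
      ∫ u in Ioi 1, legQ s u * legQ t u =
        4 * (digamma s - digamma t) / (s * (s - 1) - t * (t - 1)) := by
  have hk : s * (s - 1) - t * (t - 1) ≠ 0 := by
    rw [show s * (s - 1) - t * (t - 1) = (s - t) * (s + t - 1) by ring]
    exact mul_ne_zero (sub_ne_zero.2 hne) (by linarith)
  set k := s * (s - 1) - t * (t - 1) with hk_def
  let F : ℝ → ℝ := Function.update (fun u => legWronskian s t u / k) 1
    (4 * (digamma t - digamma s) / k)
  have hF : ∀ u : ℝ, 1 < u → F =ᶠ[𝓝 u] fun u => legWronskian s t u / k := by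
    intro u hu
    filter_upwards [lt_mem_nhds hu] with v hv using Function.update_of_ne hv.ne' _ _
  have hcont : ContinuousWithinAt F (Ici 1) 1 := by
    rw [continuousWithinAt_update_same, Ici_sdiff_left]
    exact (tendsto_legWronskian_one hs ht).div_const k
  have hderiv : ∀ u ∈ Ioi (1 : ℝ), HasDerivAt F (legQ s u * legQ t u) u := by
    intro u hu
    refine HasDerivAt.congr_of_eventuallyEq ?_ (hF u hu)
    refine ((hasDerivAt_legWronskian hs ht hu).div_const k).congr_deriv ?_
    rw [← hk_def, mul_div_cancel_left₀ _ hk]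
  have hpos : ∀ u ∈ Ioi (1 : ℝ), 0 ≤ legQ s u * legQ t u := fun u hu =>
    mul_nonneg (legQ_nonneg hs hu) (legQ_nonneg ht hu)
  have htop : Tendsto F atTop (𝓝 0) := by
    have h := (tendsto_legWronskian_atTop hs ht hst).div_const k
    rw [zero_div] at h
    refine h.congr' ?_
    filter_upwards [eventually_gt_atTop 1] with u hu
    exact (hF u hu).self_of_nhds.symm
  refine ⟨integrableOn_Ioi_deriv_of_nonneg hcont hderiv hpos htop, ?_⟩
  rw [integral_Ioi_of_hasDerivAt_of_nonneg hcont hderiv hpos htop]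
  simp only [F, Function.update_self]
  ring

end Legendre

/-! ### The propagator in two dimensions -/

lemma ascPochhammer_eval_eq_Gamma_div {x : ℝ} (hx : 0 < x) (n : ℕ) :
    (ascPochhammer ℝ n).eval x = Real.Gamma (x + n) / Real.Gamma x := by
  have hx' := (Real.Gamma_pos_of_pos hx).ne'
  induction n with
  | zero => simp [hx']
  | succ n ih =>
    have h : x + n ≠ 0 := by positivity
    rw [ascPochhammer_succ_eval, ih]
    push_cast
    rw [← add_assoc, Real.Gamma_add_one h]
    ring

lemma adsG_two_eq {μ u : ℝ} (hμ : 0 < μ) (hu : 1 < u) :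
    adsG 2 μ u = legQ (μ + 1 / 2) u / (4 * Real.pi) := by
  have hu0 : 0 < u := by linarith
  have h₁ : 0 < (μ + 1 / 2) / 2 := by linarith
  have h₂ : 0 < (μ + 1 / 2) / 2 + 1 / 2 := by linarith
  have h₃ : 0 < μ + 1 := by linarith
  have g₁ := Real.Gamma_pos_of_pos h₁
  have g₂ := Real.Gamma_pos_of_pos h₂
  have g₃ := Real.Gamma_pos_of_pos h₃
  have hdup := Real.Gamma_mul_Gamma_add_half ((μ + 1 / 2) / 2)
  rw [show 2 * ((μ + 1 / 2) / 2) = μ + 1 / 2 by ring] at hdup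
  have hπ := Real.pi_pos
  have hsq : √Real.pi * √Real.pi = Real.pi := Real.mul_self_sqrt hπ.le
  have hsq0 : 0 < √Real.pi := Real.sqrt_pos.2 hπ
  rw [adsG, legQ, invPowSeries_eq hu0, ← tsum_mul_left, ← tsum_mul_left, ← tsum_div_const]
  congr 1 with n
  rw [show ((2 : ℝ) - 1) / 4 + μ / 2 = (μ + 1 / 2) / 2 by ring,
    show ((2 : ℝ) + 1) / 4 + μ / 2 = (μ + 1 / 2) / 2 + 1 / 2 by ring,
    show ((2 : ℝ) - 1) / 2 + μ = μ + 1 / 2 by ring,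
    show ((2 : ℝ) - 1) / 2 = 1 / 2 by ring,
    ascPochhammer_eval_eq_Gamma_div h₁, ascPochhammer_eval_eq_Gamma_div h₂,
    ascPochhammer_eval_eq_Gamma_div h₃, ← Real.sqrt_eq_rpow, Real.mul_rpow (by norm_num) hu0.le,
    Real.rpow_mul hu0.le, Real.rpow_natCast, Real.rpow_neg hu0.le (μ + 1 / 2), legCoeff,
    show μ + 1 / 2 + 1 / 2 + (n : ℝ) = μ + 1 + n by ring]
  have g₄ : 0 < Real.Gamma (μ + 1 + n) := Real.Gamma_pos_of_pos (by positivity)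
  have hf : (0 : ℝ) < n.factorial := by positivity
  have hp : 0 < (2 : ℝ) ^ (μ + 1 / 2) := by positivity
  have hq : 0 < u ^ (μ + 1 / 2) := by positivity
  have h2 : (2 : ℝ) ^ (1 - (μ + 1 / 2)) = 2 / 2 ^ (μ + 1 / 2) := by
    rw [Real.rpow_sub (by norm_num), Real.rpow_one]
  rw [h2] at hdup
  have hΓ : Real.Gamma (μ + 1 / 2) = Real.Gamma ((μ + 1 / 2) / 2) *
      Real.Gamma ((μ + 1 / 2) / 2 + 1 / 2) * 2 ^ (μ + 1 / 2) / (2 * √Real.pi) := by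
    rw [hdup]
    field_simp
  rw [hΓ]
  generalize (u ^ (-2 : ℝ)) ^ n = X
  rw [show 4 * Real.pi = 4 * (√Real.pi * √Real.pi) by rw [hsq]]
  field_simp
  ring

/-- The two-dimensional one-loop bubble integral. -/
theorem one_loop_bubble_dim_two (lam nu : ℝ) (hlam : 0 < lam) (hnu : 0 < nu)
    (hne : lam ≠ nu) :
    IntegrableOn (fun u : ℝ => adsG 2 lam u * adsG 2 nu u) (Set.Ioi 1) ∧
    (2 * Real.pi) * ∫ u in Set.Ioi (1 : ℝ), adsG 2 lam u * adsG 2 nu u =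
      (digamma (lam + 1 / 2) - digamma (nu + 1 / 2)) /
        (2 * Real.pi * (lam ^ 2 - nu ^ 2)) := by
  obtain ⟨hint, hval⟩ := integrableOn_and_integral_legQ_mul_legQ
    (by linarith : 0 < lam + 1 / 2) (by linarith : 0 < nu + 1 / 2) (by linarith)
    (fun h => hne (by linarith))
  have heq : ∀ u ∈ Ioi (1 : ℝ), adsG 2 lam u * adsG 2 nu u =
      (legQ (lam + 1 / 2) u * legQ (nu + 1 / 2) u) / (16 * Real.pi ^ 2) := by
    intro u hu
    rw [adsG_two_eq hlam hu, adsG_two_eq hnu hu]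
    ring
  refine ⟨(integrableOn_congr_fun heq measurableSet_Ioi).2 (hint.div_const _), ?_⟩
  rw [setIntegral_congr_fun measurableSet_Ioi heq, integral_div, hval]
  have hk : lam ^ 2 - nu ^ 2 ≠ 0 := by
    rw [sq_sub_sq]
    exact mul_ne_zero (by positivity) (sub_ne_zero.2 hne)
  rw [show (lam + 1 / 2) * (lam + 1 / 2 - 1) - (nu + 1 / 2) * (nu + 1 / 2 - 1) =
    lam ^ 2 - nu ^ 2 by ring]
  have hπ := Real.pi_pos
  field_simp
  ring
end
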